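/- arXiv:2306.13635 — 2 statements merged into one kernel-verified Lean document; each statement's English description precedes it below -/
import Mathlib

section
/- Let m ≥ 1 and N = 2m, let a_1,…,a_k be complex numbers, let g(z) = ∏_{i=1}^k (1 − a_i z), and let φ(e^{iθ}) = g(e^{iθ})·g(e^{−iθ}) with Fourier coefficients φ_n = (1/2π)∫_0^{2π} φ(e^{iθ}) e^{−inθ} dθ. Then ∫_{USp(N)} ∏_{i=1}^k det(I − a_i u) du = det[(φ_{j−k} − φ_{j+k+2})_{0≤j,k≤m−1}]. -/
open MeasureTheory Matrix

instance matrixMS {m n α : Type*} [MeasurableSpace α] : MeasurableSpace (Matrix m n α) :=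
  inferInstanceAs (MeasurableSpace (m → n → α))

/-- The compact symplectic group `USp(2m)`: unitary `2m × 2m` matrices that are symplectic. -/
def USp (m : ℕ) : Subgroup (Matrix.unitaryGroup (Fin m ⊕ Fin m) ℂ) where
  carrier := {u | (u : Matrix (Fin m ⊕ Fin m) (Fin m ⊕ Fin m) ℂ) ∈ Matrix.symplecticGroup (Fin m) ℂ}
  one_mem' := by
    simpa using (Matrix.symplecticGroup (Fin m) ℂ).one_mem
  mul_mem' := by
    intro x y hx hy
    simp only [Set.mem_setOf_eq] at *
    rw [Submonoid.coe_mul]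
    exact (Matrix.symplecticGroup (Fin m) ℂ).mul_mem hx hy
  inv_mem' := by
    intro u hu
    simp only [Set.mem_setOf_eq, SetLike.mem_coe] at *
    have h1 : ((u : Matrix (Fin m ⊕ Fin m) (Fin m ⊕ Fin m) ℂ))⁻¹ ∈ Matrix.symplecticGroup (Fin m) ℂ := by
      have := ((⟨(u : Matrix (Fin m ⊕ Fin m) (Fin m ⊕ Fin m) ℂ), hu⟩ :
        Matrix.symplecticGroup (Fin m) ℂ)⁻¹).2
      rwa [SymplecticGroup.coe_inv'] at this
    have h2 : ((u : Matrix (Fin m ⊕ Fin m) (Fin m ⊕ Fin m) ℂ))⁻¹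
        = star (u : Matrix (Fin m ⊕ Fin m) (Fin m ⊕ Fin m) ℂ) :=
      Matrix.inv_eq_left_inv u.2.1
    have h3 : ((u⁻¹ : Matrix.unitaryGroup (Fin m ⊕ Fin m) ℂ) :
        Matrix (Fin m ⊕ Fin m) (Fin m ⊕ Fin m) ℂ)
        = star (u : Matrix (Fin m ⊕ Fin m) (Fin m ⊕ Fin m) ℂ) := rfl
    rw [h3, ← h2]
    exact h1

/-- The symbol `φ(e^{iθ}) = g(e^{iθ}) g(e^{-iθ})` where `g(z) = ∏_i (1 - a_i z)`. -/
noncomputable def phiGG {k : ℕ} (a : Fin k → ℂ) (θ : ℝ) : ℂ :=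
  (∏ i, (1 - a i * Complex.exp (Complex.I * θ))) *
    ∏ i, (1 - a i * Complex.exp (-Complex.I * θ))

/-- The `n`-th Fourier coefficient `φ_n = (1/2π) ∫_0^{2π} φ(e^{iθ}) e^{-inθ} dθ`. -/
noncomputable def fCoeff (f : ℝ → ℂ) (n : ℤ) : ℂ :=
  ((2 * Real.pi : ℝ) : ℂ)⁻¹ *
    ∫ θ in (0 : ℝ)..(2 * Real.pi), f θ * Complex.exp (-(n : ℂ) * Complex.I * θ)

section ChebyshevExpansion

open Polynomial

/-- The monic Chebyshev polynomial of the second kind, `S_n (x + x⁻¹) = ∑ x ^ (n - 2 r)`. -/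
noncomputable def chebS (n : ℕ) : ℂ[X] := Polynomial.Chebyshev.S ℂ n

lemma chebS_zero : chebS 0 = 1 := by simp [chebS]

lemma chebS_one : chebS 1 = X := by simp [chebS]

lemma chebS_add_two (n : ℕ) : chebS (n + 2) = X * chebS (n + 1) - chebS n := by
  simp only [chebS]
  push_cast
  exact Polynomial.Chebyshev.S_add_two ℂ n

lemma chebS_monic_natDegree (n : ℕ) : (chebS n).Monic ∧ (chebS n).natDegree = n := by
  induction n using Nat.twoStepInduction with
  | zero => simp [chebS_zero]
  | one => simp [chebS_one, monic_X]
  | more n ih₀ ih₁ =>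
    have hM : (X * chebS (n + 1)).Monic := monic_X.mul ih₁.1
    have hD : (X * chebS (n + 1)).natDegree = n + 2 := by
      rw [monic_X.natDegree_mul ih₁.1, natDegree_X, ih₁.2]; ring
    have hlt : (chebS n).degree < (X * chebS (n + 1)).degree := by
      rw [degree_eq_natDegree ih₀.1.ne_zero, degree_eq_natDegree hM.ne_zero, hD, ih₀.2]
      exact_mod_cast (by omega : n < n + 2)
    rw [chebS_add_two]
    refine ⟨hM.sub_of_left hlt, ?_⟩
    rw [natDegree_sub_eq_left_of_natDegree_lt (by rw [hD, ih₀.2]; omega), hD]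

lemma chebS_monic (n : ℕ) : (chebS n).Monic := (chebS_monic_natDegree n).1

lemma natDegree_chebS (n : ℕ) : (chebS n).natDegree = n := (chebS_monic_natDegree n).2

lemma degree_chebS (n : ℕ) : (chebS n).degree = n := by
  rw [degree_eq_natDegree (chebS_monic n).ne_zero, natDegree_chebS]

/-- The second order operator which the Chebyshev polynomials `chebS` diagonalize. -/
noncomputable def chebOp : ℂ[X] →ₗ[ℂ] ℂ[X] :=
  LinearMap.mulLeft ℂ (X ^ 2 - 4) ∘ₗ derivative ∘ₗ derivative +
    LinearMap.mulLeft ℂ (3 * X) ∘ₗ derivative + LinearMap.id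

lemma chebOp_apply (p : ℂ[X]) :
    chebOp p = (X ^ 2 - 4) * derivative (derivative p) + 3 * X * derivative p + p := by
  simp [chebOp, mul_assoc]

lemma chebOp_chebS (n : ℕ) : chebOp (chebS n) = C (((n : ℂ) + 1) ^ 2) * chebS n := by
  have hU := Polynomial.Chebyshev.one_sub_X_sq_mul_derivative_derivative_U_eq_poly_in_U (R := ℂ) n
  have hS : (chebS n).comp (2 * X) = Polynomial.Chebyshev.U ℂ n :=
    Polynomial.Chebyshev.S_comp_two_mul_X ℂ n
  have d2 : derivative (2 * X : ℂ[X]) = 2 := by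
    simp [derivative_mul]
  simp only [Function.iterate_succ, Function.iterate_zero, Function.comp, id] at hU
  rw [← hS] at hU
  simp only [derivative_comp, derivative_mul, d2] at hU
  have key : (chebOp (chebS n)).comp (2 * X) = (C (((n : ℂ) + 1) ^ 2) * chebS n).comp (2 * X) := by
    rw [chebOp_apply]
    simp only [mul_comp, add_comp, sub_comp, pow_comp, X_comp, C_comp]
    have h4 : (4 : ℂ[X]).comp (2 * X) = 4 := by simp
    have h3 : (3 : ℂ[X]).comp (2 * X) = 3 := by simp
    rw [h4, h3]
    have h2 : derivative (2 : ℂ[X]) = 0 := by simp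
    rw [h2] at hU
    simp only [map_pow, map_add, map_natCast, map_one, Int.cast_natCast] at hU ⊢
    linear_combination -hU
  have := congrArg (fun p => p.comp (C (1 / 2 : ℂ) * X)) key
  simp only [comp_assoc] at this
  have hx : (2 * X : ℂ[X]).comp (C (1 / 2 : ℂ) * X) = X := by
    simp only [mul_comp, X_comp]
    have : (2 : ℂ[X]).comp (C (1 / 2 : ℂ) * X) = C 2 := by
      rw [show (2 : ℂ[X]) = C 2 from rfl, C_comp]
    rw [this, ← mul_assoc, ← C_mul]; norm_num
  rwa [hx, comp_X, comp_X] at this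

/-- The Fourier coefficients of `θ ↦ p (2 cos θ)`. -/
noncomputable def cosCoeff (p : ℂ[X]) (n : ℤ) : ℂ :=
  fCoeff (fun θ : ℝ => p.eval (Complex.exp (Complex.I * θ) + Complex.exp (-Complex.I * θ))) n

lemma fCoeff_add {f g : ℝ → ℂ} (hf : Continuous f) (hg : Continuous g) (n : ℤ) :
    fCoeff (fun θ => f θ + g θ) n = fCoeff f n + fCoeff g n := by
  simp only [fCoeff, add_mul]
  rw [intervalIntegral.integral_add, mul_add] <;>
    exact Continuous.intervalIntegrable (by fun_prop) _ _

lemma fCoeff_const_mul (c : ℂ) (f : ℝ → ℂ) (n : ℤ) :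
    fCoeff (fun θ => c * f θ) n = c * fCoeff f n := by
  simp only [fCoeff, mul_assoc]
  rw [intervalIntegral.integral_const_mul]
  ring

lemma continuous_eval_cos (p : ℂ[X]) : Continuous fun θ : ℝ =>
    p.eval (Complex.exp (Complex.I * θ) + Complex.exp (-Complex.I * θ)) := by
  fun_prop

lemma cosCoeff_X_mul (p : ℂ[X]) (n : ℤ) :
    cosCoeff (X * p) n = cosCoeff p (n - 1) + cosCoeff p (n + 1) := by
  simp only [cosCoeff, fCoeff, eval_mul, eval_X]
  rw [← mul_add, ← intervalIntegral.integral_add]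
  · congr 2
    funext θ
    rw [← mul_add, mul_comm (_ + _) (eval _ p), mul_assoc, add_mul, ← Complex.exp_add,
      ← Complex.exp_add]
    congr 3 <;> · push_cast; ring
  · exact Continuous.intervalIntegrable (by fun_prop) _ _
  · exact Continuous.intervalIntegrable (by fun_prop) _ _

lemma cosCoeff_add (p q : ℂ[X]) (n : ℤ) : cosCoeff (p + q) n = cosCoeff p n + cosCoeff q n := by
  simp only [cosCoeff, eval_add]
  exact fCoeff_add (continuous_eval_cos p) (continuous_eval_cos q) n

lemma cosCoeff_C_mul (c : ℂ) (p : ℂ[X]) (n : ℤ) : cosCoeff (C c * p) n = c * cosCoeff p n := by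
  simp only [cosCoeff, eval_mul, eval_C]
  exact fCoeff_const_mul c _ n

lemma cosCoeff_one (n : ℤ) : cosCoeff 1 n = if n = 0 then 1 else 0 := by
  simp only [cosCoeff, fCoeff, eval_one, one_mul]
  have h2 : ((2 * Real.pi : ℝ) : ℂ) ≠ 0 := by
    exact_mod_cast Real.two_pi_pos.ne'
  split_ifs with h
  · subst h
    simp only [Int.cast_zero, neg_zero, zero_mul, Complex.exp_zero, intervalIntegral.integral_const]
    rw [sub_zero, Complex.real_smul, mul_one, inv_mul_cancel₀ h2]
  · have hc : (-(n : ℂ) * Complex.I) ≠ 0 := by simp [h]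
    rw [integral_exp_mul_complex hc]
    have : Complex.exp (-(n : ℂ) * Complex.I * ((2 * Real.pi : ℝ) : ℂ)) = 1 := by
      rw [Complex.exp_eq_one_iff]
      exact ⟨-n, by push_cast; ring⟩
    rw [this]
    simp

/-- The coefficient of `chebS n` in the Chebyshev expansion of a polynomial. -/
noncomputable def chebCoeff (n : ℕ) : ℂ[X] →ₗ[ℂ] ℂ where
  toFun p := cosCoeff p n - cosCoeff p (n + 2)
  map_add' p q := by simp only [cosCoeff_add]; ring
  map_smul' c p := by simp only [smul_eq_C_mul, cosCoeff_C_mul]; simp [mul_sub]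

lemma cosCoeff_mul_chebS (p : ℂ[X]) (k : ℕ) (j : ℤ) :
    cosCoeff (p * chebS k) j - cosCoeff (p * chebS k) (j + 2) =
      cosCoeff p (j - k) - cosCoeff p (j + k + 2) := by
  induction k using Nat.twoStepInduction generalizing p with
  | zero => simp [chebS_zero]
  | one =>
    rw [chebS_one, mul_comm, cosCoeff_X_mul, cosCoeff_X_mul]
    push_cast
    ring_nf
  | more n ih₀ ih₁ =>
    have e : p * chebS (n + 2) = (X * p) * chebS (n + 1) + C (-1) * (p * chebS n) := by
      rw [chebS_add_two, C_neg, C_1]; ring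
    have h₁ := ih₁ (X * p)
    rw [cosCoeff_X_mul, cosCoeff_X_mul] at h₁
    rw [e, cosCoeff_add, cosCoeff_add, cosCoeff_C_mul, cosCoeff_C_mul]
    have h₀ := ih₀ p
    push_cast at h₁ ⊢
    rw [show j - (n + 1 : ℤ) - 1 = j - (n + 2) by ring, show j - (n + 1 : ℤ) + 1 = j - n by ring,
      show j + (n + 1 : ℤ) + 2 - 1 = j + n + 2 by ring,
      show j + (n + 1 : ℤ) + 2 + 1 = j + (n + 2) + 2 by ring] at h₁
    linear_combination h₁ - h₀

lemma chebCoeff_mul_chebS (p : ℂ[X]) (j k : ℕ) :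
    chebCoeff j (p * chebS k) = cosCoeff p ((j : ℤ) - k) - cosCoeff p ((j : ℤ) + k + 2) :=
  cosCoeff_mul_chebS p k j

lemma chebCoeff_chebS (j k : ℕ) : chebCoeff j (chebS k) = if j = k then 1 else 0 := by
  have h := chebCoeff_mul_chebS 1 j k
  rw [one_mul] at h
  rw [h, cosCoeff_one, cosCoeff_one, if_neg (by omega : ¬ ((j : ℤ) + k + 2 = 0)), sub_zero]
  congr 1
  simp [sub_eq_zero]

lemma sum_chebCoeff (n : ℕ) (p : ℂ[X]) (hp : p.degree < n) :
    p = ∑ e : Fin n, C (chebCoeff e p) * chebS e := by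
  have hex : ∀ n : ℕ, ∀ p : ℂ[X], p.degree < n → ∃ c : ℕ → ℂ,
      p = ∑ e ∈ Finset.range n, C (c e) * chebS e := by
    intro n
    induction n with
    | zero =>
      intro p hp
      refine ⟨0, ?_⟩
      simpa [Nat.WithBot.lt_zero_iff] using hp
    | succ n ih =>
      intro p hp
      have hlt : (p - C (p.coeff n) * chebS n).degree < n := by
        rw [degree_lt_iff_coeff_zero] at hp ⊢
        intro r hr
        rcases hr.eq_or_lt with rfl | hr
        · have := (chebS_monic n).coeff_natDegree
          rw [natDegree_chebS] at this
          simp [this]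
        · have h0 : (chebS n).coeff r = 0 :=
            coeff_eq_zero_of_natDegree_lt (by rw [natDegree_chebS]; exact hr)
          rw [coeff_sub, hp r hr, coeff_C_mul, h0]
          simp
      obtain ⟨c, hc⟩ := ih _ hlt
      refine ⟨Function.update c n (p.coeff n), ?_⟩
      rw [Finset.sum_range_succ, Function.update_self, ← sub_eq_iff_eq_add, hc]
      refine Finset.sum_congr rfl fun e he => ?_
      rw [Function.update_of_ne (Finset.mem_range.1 he).ne]
  obtain ⟨c, hc⟩ := hex n p hp
  have hcoef : ∀ e < n, chebCoeff e p = c e := by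
    intro e he
    rw [hc, map_sum]
    simp only [← smul_eq_C_mul, map_smul, chebCoeff_chebS, smul_eq_mul, mul_ite, mul_one, mul_zero]
    rw [Finset.sum_ite_eq, if_pos (Finset.mem_range.2 he)]
  rw [Finset.sum_fin_eq_sum_range]
  conv_lhs => rw [hc]
  refine Finset.sum_congr rfl fun e he => ?_
  rw [dif_pos (Finset.mem_range.1 he), hcoef e (Finset.mem_range.1 he)]

lemma chebCoeff_eq_zero (n : ℕ) (p : ℂ[X]) (hp : p.degree < n) : chebCoeff n p = 0 := by
  rw [sum_chebCoeff n p hp, map_sum]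
  refine Finset.sum_eq_zero fun e _ => ?_
  rw [← smul_eq_C_mul, map_smul, chebCoeff_chebS, if_neg e.2.ne', smul_zero]

lemma chebCoeff_natDegree (p : ℂ[X]) : chebCoeff p.natDegree p = p.leadingCoeff := by
  have h : chebCoeff p.natDegree (p - C p.leadingCoeff * chebS p.natDegree) = 0 := by
    refine chebCoeff_eq_zero _ _ ?_
    rw [degree_lt_iff_coeff_zero]
    intro r hr
    rcases hr.eq_or_lt with rfl | hr
    · have := (chebS_monic p.natDegree).coeff_natDegree
      rw [natDegree_chebS] at this
      simp [this]
    · have h0 : (chebS p.natDegree).coeff r = 0 :=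
        coeff_eq_zero_of_natDegree_lt (by rw [natDegree_chebS]; exact hr)
      rw [coeff_sub, coeff_eq_zero_of_natDegree_lt hr, coeff_C_mul, h0]
      simp
  rw [map_sub, ← smul_eq_C_mul, map_smul, chebCoeff_chebS, if_pos rfl, sub_eq_zero] at h
  simpa using h

end ChebyshevExpansion

section Determinants

open Polynomial

/-- The permutation of `Fin m ⊕ Fin k` comparing the two ways of listing it as `Fin (m + k)`. -/
def blockSwap (m k : ℕ) : Equiv.Perm (Fin m ⊕ Fin k) :=
  ((Equiv.sumComm _ _).trans (finSumFinEquiv.trans (finCongr (add_comm k m)))).trans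
    finSumFinEquiv.symm

lemma finSumFinEquiv_blockSwap_inl (m k : ℕ) (j : Fin m) :
    ((finSumFinEquiv (blockSwap m k (Sum.inl j)) : Fin (m + k)) : ℕ) = k + j := by
  simp [blockSwap, add_comm]

lemma finSumFinEquiv_blockSwap_inr (m k : ℕ) (i : Fin k) :
    ((finSumFinEquiv (blockSwap m k (Sum.inr i)) : Fin (m + k)) : ℕ) = i := by
  simp [blockSwap]

lemma det_chebCoeff_mul_det_eval (m k : ℕ) (φ : ℂ[X]) (hφ : φ.natDegree = k)
    (hφ0 : φ ≠ 0) (b : Fin k → ℂ) (hb : ∀ i, φ.eval (b i) = 0) :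
    (Matrix.of fun j j' : Fin m => chebCoeff j (φ * chebS j')).det *
        (Matrix.of fun i j : Fin k => (chebS j).eval (b i)).det =
      (Equiv.Perm.sign (blockSwap m k) : ℂ) * φ.leadingCoeff ^ m *
        (Matrix.of fun i j : Fin k => (chebS (m + j)).eval (b i)).det := by
  have hdeg : ∀ j : Fin m, (φ * chebS j).natDegree = k + j := fun j => by
    rw [natDegree_mul hφ0 (chebS_monic _).ne_zero, hφ, natDegree_chebS]
  set β : Fin m ⊕ Fin k → ℂ[X] := Sum.elim (fun j => φ * chebS j) (fun i => chebS i) with hβ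
  have hβdeg : ∀ x, (β x).degree < (m + k : ℕ) := by
    rintro (j | i)
    · refine lt_of_le_of_lt degree_le_natDegree ?_
      simp only [hβ, Sum.elim_inl, hdeg]
      exact_mod_cast (by omega : k + (j : ℕ) < m + k)
    · simp only [hβ, Sum.elim_inr, degree_chebS]
      exact_mod_cast (by omega : (i : ℕ) < m + k)
  set Cm : Matrix (Fin m ⊕ Fin k) (Fin m ⊕ Fin k) ℂ :=
    Matrix.of fun e x => chebCoeff (finSumFinEquiv e : Fin (m + k)) (β x) with hCm
  have hexp : ∀ x, β x = ∑ e : Fin m ⊕ Fin k,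
      C (Cm e x) * chebS (finSumFinEquiv e : Fin (m + k)) := by
    intro x
    conv_lhs => rw [sum_chebCoeff (m + k) (β x) (hβdeg x)]
    exact (Equiv.sum_comp finSumFinEquiv _).symm
  set G : Matrix (Fin m ⊕ Fin k) (Fin m ⊕ Fin k) ℂ :=
    fromBlocks 1 0 (Matrix.of fun i j => (chebS j).eval (b i))
      (Matrix.of fun i j => (chebS (m + j)).eval (b i)) with hG
  have hGC : G * Cm = fromBlocks (Matrix.of fun j j' : Fin m => chebCoeff j (φ * chebS j'))
      (Matrix.of fun (j : Fin m) (i : Fin k) => chebCoeff j (chebS i)) 0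
      (Matrix.of fun i j : Fin k => (chebS j).eval (b i)) := by
    ext r x
    rcases r with j | i
    · have : (G * Cm) (Sum.inl j) x = chebCoeff j (β x) := by
        simp [Matrix.mul_apply, hG, hCm, Matrix.one_apply]
      rw [this]
      rcases x with j' | i' <;> simp [hβ]
    · have : (G * Cm) (Sum.inr i) x = (β x).eval (b i) := by
        rw [hexp x, eval_finsetSum, Matrix.mul_apply]
        refine Finset.sum_congr rfl fun e _ => ?_
        rw [eval_mul, eval_C, mul_comm]
        rcases e with e | e <;> simp [hG]
      rw [this]
      rcases x with j' | i' <;> simp [hβ, hb]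
  have hC : Cm.det = (Equiv.Perm.sign (blockSwap m k) : ℂ) * φ.leadingCoeff ^ m := by
    have hsub : Cm.submatrix (blockSwap m k) id =
        fromBlocks (Matrix.of fun j j' : Fin m => chebCoeff (k + j) (φ * chebS j')) 0
          (Matrix.of fun (i : Fin k) (j : Fin m) => chebCoeff i (φ * chebS j)) 1 := by
      ext r x
      rcases r with r | r <;> rcases x with x | x <;>
        simp only [hCm, submatrix_apply, of_apply, finSumFinEquiv_blockSwap_inl,
          finSumFinEquiv_blockSwap_inr, hβ, Sum.elim_inl, Sum.elim_inr, fromBlocks_apply₁₁,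
          fromBlocks_apply₁₂, fromBlocks_apply₂₁, fromBlocks_apply₂₂, id, chebCoeff_chebS,
          Matrix.zero_apply, Matrix.one_apply, Fin.ext_iff]
      rw [if_neg (by omega)]
    have htri : (Matrix.of fun j j' : Fin m => chebCoeff (k + j) (φ * chebS j')).det =
        φ.leadingCoeff ^ m := by
      rw [det_of_isUpperTriangular]
      · have : ∀ j : Fin m, chebCoeff (k + j) (φ * chebS j) = φ.leadingCoeff := fun j => by
          rw [← hdeg j, chebCoeff_natDegree, leadingCoeff_mul, (chebS_monic _).leadingCoeff,
            mul_one]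
        simp [this]
      · intro j j' hlt
        refine chebCoeff_eq_zero _ _ (lt_of_le_of_lt degree_le_natDegree ?_)
        rw [hdeg]
        have : (j' : ℕ) < j := hlt
        exact_mod_cast (by omega : k + (j' : ℕ) < k + j)
    have hd := Matrix.det_permute (blockSwap m k) Cm
    rw [hsub, det_fromBlocks_zero₁₂, htri, det_one, mul_one] at hd
    rw [hd, ← mul_assoc]
    norm_cast
    simp
  have := congrArg Matrix.det hGC
  rw [det_mul, hC, hG, det_fromBlocks_zero₁₂, det_fromBlocks_zero₂₁, det_one, one_mul] at this
  rw [← this]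
  ring

lemma det_sum_mul_eq_sum_det {k n : ℕ} (s : Fin k → Fin n → ℂ) (P : Fin k → Fin n → ℂ) :
    (Matrix.of fun i j : Fin k => ∑ e, s i e * P j e).det =
      ∑ e : Fin k → Fin n, (∏ i, s i (e i)) * (Matrix.of fun i j : Fin k => P j (e i)).det := by
  have h : (Matrix.of fun i j : Fin k => ∑ e, s i e * P j e) =
      fun i => ∑ e : Fin n, s i e • (fun j => P j e) := by
    ext i j
    simp
  rw [h]
  change detRowAlternating _ = _
  rw [← AlternatingMap.coe_multilinearMap, MultilinearMap.map_sum]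
  refine Finset.sum_congr rfl fun e _ => ?_
  rw [MultilinearMap.map_smul_univ]
  rfl

lemma image_eq_of_sum_sq_eq {m k : ℕ} (e : Fin k → Fin (m + k)) (he : Function.Injective e)
    (hsum : ∑ i, ((e i : ℕ) + 1) ^ 2 = ∑ j : Fin k, (m + j + 1) ^ 2) (i : Fin k) :
    m ≤ (e i : ℕ) := by
  classical
  set s : Finset ℕ := Finset.univ.image fun i => (e i : ℕ) with hs
  set B : Finset ℕ := Finset.Ico m (m + k) with hB
  have hinj : Function.Injective fun i => (e i : ℕ) := Fin.val_injective.comp he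
  have hsc : s.card = k := by
    rw [hs, Finset.card_image_of_injective _ hinj, Finset.card_univ, Fintype.card_fin]
  have hBc : B.card = k := by simp [hB]
  have hss : ∑ x ∈ s, (x + 1) ^ 2 = ∑ x ∈ B, (x + 1) ^ 2 := by
    rw [hs, Finset.sum_image fun _ _ _ _ h => hinj h, hsum, hB, Finset.sum_Ico_eq_sum_range,
      Nat.add_sub_cancel_left, ← Fin.sum_univ_eq_sum_range (fun j => (m + j + 1) ^ 2)]
  have hc : (s \ B).card = (B \ s).card := by
    have h1 := Finset.card_sdiff_add_card_inter s B
    have h2 := Finset.card_sdiff_add_card_inter B s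
    rw [Finset.inter_comm] at h2
    omega
  have hd : ∑ x ∈ s \ B, (x + 1) ^ 2 = ∑ x ∈ B \ s, (x + 1) ^ 2 := by
    have h1 := Finset.sum_inter_add_sum_sdiff s B (fun x => (x + 1) ^ 2)
    have h2 := Finset.sum_inter_add_sum_sdiff B s (fun x => (x + 1) ^ 2)
    rw [Finset.inter_comm] at h2
    omega
  have hlt : ∀ x ∈ s \ B, (x + 1) ^ 2 ≤ m ^ 2 := by
    intro x hx
    rw [Finset.mem_sdiff, hs, hB] at hx
    obtain ⟨⟨i, -, rfl⟩, h2⟩ := by simpa only [Finset.mem_image] using hx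
    have := (e i).2
    rw [Finset.mem_Ico] at h2
    exact Nat.pow_le_pow_left (by omega) 2
  have hge : ∀ x ∈ B \ s, (m + 1) ^ 2 ≤ (x + 1) ^ 2 := by
    intro x hx
    rw [Finset.mem_sdiff, hB, Finset.mem_Ico] at hx
    exact Nat.pow_le_pow_left (by omega) 2
  have h1 := Finset.sum_le_card_nsmul _ _ _ hlt
  have h2 := Finset.card_nsmul_le_sum _ _ _ hge
  rw [hd, hc] at h1
  have hz : (B \ s).card = 0 := by
    by_contra hne
    have hpos : 0 < (B \ s).card := Nat.pos_of_ne_zero hne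
    have := h2.trans h1
    simp only [smul_eq_mul] at this
    have := Nat.le_of_mul_le_mul_left this hpos
    have h3 : m ^ 2 < (m + 1) ^ 2 := Nat.pow_lt_pow_left (by omega) (by norm_num)
    omega
  rw [← hc, Finset.card_eq_zero, Finset.sdiff_eq_empty_iff_subset] at hz
  have : (e i : ℕ) ∈ B := hz (Finset.mem_image_of_mem _ (Finset.mem_univ i))
  rw [hB, Finset.mem_Ico] at this
  exact this.1

lemma eq_zero_of_sum_mul_prod_eq_zero {k n : ℕ} (A : Fin k → Matrix (Fin n) (Fin n) ℂ)
    (hA : ∀ i, IsUnit (A i).det) (c : (Fin k → Fin n) → ℂ)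
    (h : ∀ r : Fin k → Fin n, ∑ e, c e * ∏ i, A i (r i) (e i) = 0) : c = 0 := by
  funext e₀
  have h1 : ∑ r : Fin k → Fin n, (∏ i, (A i)⁻¹ (e₀ i) (r i)) *
      ∑ e, c e * ∏ i, A i (r i) (e i) = 0 :=
    Finset.sum_eq_zero fun r _ => by rw [h r, mul_zero]
  simp only [Finset.mul_sum] at h1
  rw [Finset.sum_comm] at h1
  have h2 : ∀ e : Fin k → Fin n, ∑ r : Fin k → Fin n, (∏ i, (A i)⁻¹ (e₀ i) (r i)) *
      (c e * ∏ i, A i (r i) (e i)) = if e₀ = e then c e else 0 := by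
    intro e
    have : ∀ i, ∑ r, (A i)⁻¹ (e₀ i) r * A i r (e i) = if e₀ i = e i then 1 else 0 := fun i => by
      rw [← Matrix.mul_apply, Matrix.nonsing_inv_mul _ (hA i), Matrix.one_apply]
    calc _ = c e * ∑ r : Fin k → Fin n, ∏ i, ((A i)⁻¹ (e₀ i) (r i) * A i (r i) (e i)) := by
          rw [Finset.mul_sum]
          refine Finset.sum_congr rfl fun r _ => ?_
          rw [Finset.prod_mul_distrib]
          ring
      _ = c e * ∏ i, ∑ r, (A i)⁻¹ (e₀ i) r * A i r (e i) := by
          rw [Finset.prod_univ_sum, Fintype.piFinset_univ]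
      _ = _ := by
          simp only [this]
          rw [Finset.prod_ite_zero]
          simp [funext_iff]
  simp only [h2] at h1
  simpa using h1

lemma det_eval_chebS (k : ℕ) (b : Fin k → ℂ) :
    (Matrix.of fun i j : Fin k => (chebS j).eval (b i)).det = (vandermonde b).det :=
  (det_eval_matrixOfPolynomials_eq_det_vandermonde b (fun j => chebS j)
    (fun j => natDegree_chebS j) (fun j => chebS_monic j)).symm

lemma det_eval_chebS_ne_zero {k : ℕ} {b : Fin k → ℂ} (hb : Function.Injective b) :
    (Matrix.of fun i j : Fin k => (chebS j).eval (b i)).det ≠ 0 := by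
  rw [det_eval_chebS]
  exact det_vandermonde_ne_zero_iff.2 hb

lemma sum_det_updateRow_mul {k : ℕ} (A : Matrix (Fin k) (Fin k) ℂ) (d : Fin k → ℂ) :
    ∑ i, (A.updateRow i fun j => d j * A i j).det = (∑ j, d j) * A.det := by
  have h : ∀ i, (A.updateRow i fun j => d j * A i j).det = ∑ j, d j * (A.adjugate j i * A i j) := by
    intro i
    rw [← cramer_transpose_apply, cramer_eq_adjugate_mulVec, ← adjugate_transpose]
    simp only [Matrix.mulVec, dotProduct, transpose_apply]
    exact Finset.sum_congr rfl fun j _ => by ring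
  simp only [h]
  rw [Finset.sum_comm, Finset.sum_mul]
  refine Finset.sum_congr rfl fun j _ => ?_
  rw [← Finset.mul_sum, ← Matrix.mul_apply, adjugate_mul]
  simp

lemma det_updateRow_derivative_chebS {k : ℕ} {b : Fin k → ℂ} (hb : Function.Injective b)
    (i : Fin k) :
    ((Matrix.of fun i j : Fin k => (chebS j).eval (b i)).updateRow i
        fun j => (derivative (chebS j)).eval (b i)).det =
      (Matrix.of fun i j : Fin k => (chebS j).eval (b i)).det *
        ∑ l ∈ Finset.univ.erase i, (b i - b l)⁻¹ := by
  classical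
  set A : Matrix (Fin k) (Fin k) ℂ := Matrix.of fun i j : Fin k => (chebS j).eval (b i) with hA
  have hrow : ∀ v : Fin k → ℂ, (A.updateRow i v).det = ∑ j, A.adjugate j i * v j := by
    intro v
    rw [← cramer_transpose_apply, cramer_eq_adjugate_mulVec, ← adjugate_transpose]
    simp only [Matrix.mulVec, dotProduct, transpose_apply]
  set V : ℂ[X] := ∑ j : Fin k, C (A.adjugate j i) * chebS j with hV
  have hVeval : ∀ x, V.eval x = (A.updateRow i fun j => (chebS j).eval x).det := by
    intro x
    rw [hrow, hV, eval_finsetSum]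
    simp
  set N : ℂ[X] := Lagrange.nodal (Finset.univ.erase i) b with hN
  have hN0 : N.eval (b i) ≠ 0 := by
    rw [hN, Lagrange.eval_nodal, Finset.prod_ne_zero_iff]
    intro l hl
    exact sub_ne_zero.2 fun h => (Finset.ne_of_mem_erase hl) (hb h).symm
  have hVN : V = C (A.det / N.eval (b i)) * N := by
    refine eq_of_degrees_lt_of_eval_index_eq (s := Finset.univ) (v := b) hb.injOn ?_ ?_ ?_
    · rw [Finset.card_univ, Fintype.card_fin]
      refine lt_of_le_of_lt (degree_sum_le _ _) ((Finset.sup_lt_iff (WithBot.bot_lt_coe k)).2 ?_)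
      intro j _
      rw [← smul_eq_C_mul]
      refine lt_of_le_of_lt (degree_smul_le _ _) ?_
      rw [degree_chebS]
      exact WithBot.coe_lt_coe.2 j.2
    · rw [← smul_eq_C_mul]
      refine lt_of_le_of_lt (degree_smul_le _ _) ?_
      rw [hN, Lagrange.degree_nodal]
      exact_mod_cast Finset.card_erase_lt_of_mem (Finset.mem_univ i)
    · intro l _
      rw [hVeval, eval_mul, eval_C]
      rcases eq_or_ne l i with rfl | hli
      · rw [div_mul_cancel₀ _ hN0]
        congr 1
        exact updateRow_eq_self A l
      · rw [hN, Lagrange.eval_nodal_at_node (Finset.mem_erase.2 ⟨hli, Finset.mem_univ l⟩), mul_zero]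
        refine det_zero_of_row_eq hli.symm ?_
        rw [updateRow_self, updateRow_ne hli]
        rfl
  have hder : ((A.updateRow i fun j => (derivative (chebS j)).eval (b i))).det =
      (derivative V).eval (b i) := by
    rw [hrow, hV, derivative_sum, eval_finsetSum]
    simp
  rw [hder, hVN, derivative_C_mul, eval_mul, eval_C, hN, Lagrange.derivative_nodal, eval_finsetSum,
    ← hN, Finset.mul_sum, Finset.mul_sum]
  refine Finset.sum_congr rfl fun l hl => ?_
  have hl0 : b i - b l ≠ 0 :=
    sub_ne_zero.2 fun h => (Finset.ne_of_mem_erase hl) (hb h).symm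
  have hNl : N.eval (b i) =
      (b i - b l) * (Lagrange.nodal ((Finset.univ.erase i).erase l) b).eval (b i) := by
    rw [hN, Lagrange.nodal_eq_mul_nodal_erase hl]
    simp
  rw [hNl] at hN0 ⊢
  have := right_ne_zero_of_mul hN0
  field_simp

end Determinants

section AlternatingExpansion

open Polynomial

/-- The coefficient of `∏ i, chebS (e i) (b i)` in the alternating polynomial
`det (chebS j (b i)) * ∏ i, h (b i)`. -/
noncomputable def wedgeCoeff {k n : ℕ} (h : ℂ[X]) (e : Fin k → Fin n) : ℂ :=
  (Matrix.of fun i j : Fin k => chebCoeff (e i) (chebS j * h)).det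

variable {m k : ℕ}

lemma degree_chebS_mul_lt {h : ℂ[X]} (hd : h.natDegree = m) (j : Fin k) :
    (chebS j * h).degree < (m + k : ℕ) := by
  refine lt_of_le_of_lt degree_le_natDegree ?_
  have := natDegree_mul_le (p := chebS j) (q := h)
  rw [natDegree_chebS, hd] at this
  exact_mod_cast (by omega : (chebS j * h).natDegree < m + k)

lemma sum_wedgeCoeff {h : ℂ[X]} (hd : h.natDegree = m) (b : Fin k → ℂ) :
    ∑ e : Fin k → Fin (m + k), (∏ i, (chebS (e i)).eval (b i)) * wedgeCoeff h e =
      (Matrix.of fun i j : Fin k => (chebS j).eval (b i)).det * ∏ i, h.eval (b i) := by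
  simp only [wedgeCoeff]
  rw [← det_sum_mul_eq_sum_det (fun i e => (chebS e).eval (b i))
    (fun j e => chebCoeff e (chebS j * h)), mul_comm, ← det_mul_column]
  congr 1
  ext i j
  simp only [of_apply]
  rw [← eval_mul, mul_comm h]
  conv_rhs => rw [sum_chebCoeff (m + k) _ (degree_chebS_mul_lt hd j), eval_finsetSum]
  exact Finset.sum_congr rfl fun e _ => by rw [eval_mul, eval_C, mul_comm]

lemma sum_sq_mul_wedgeCoeff {h : ℂ[X]} (hd : h.natDegree = m) (b : Fin k → ℂ) :
    ∑ e : Fin k → Fin (m + k), (∑ i, ((e i : ℂ) + 1) ^ 2) *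
        ((∏ i, (chebS (e i)).eval (b i)) * wedgeCoeff h e) =
      ∑ i, (∏ l ∈ Finset.univ.erase i, h.eval (b l)) *
        ((Matrix.of fun i j : Fin k => (chebS j).eval (b i)).updateRow i
          fun j => (chebOp (chebS j * h)).eval (b i)).det := by
  classical
  simp only [Finset.sum_mul]
  rw [Finset.sum_comm]
  refine Finset.sum_congr rfl fun i _ => ?_
  set s : Fin k → Fin (m + k) → ℂ := fun l e =>
    (if l = i then ((e : ℂ) + 1) ^ 2 else 1) * (chebS e).eval (b l) with hs
  have h1 : ∀ e : Fin k → Fin (m + k),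
      ((e i : ℂ) + 1) ^ 2 * ((∏ l, (chebS (e l)).eval (b l)) * wedgeCoeff h e) =
        (∏ l, s l (e l)) * wedgeCoeff h e := by
    intro e
    simp only [hs, Finset.prod_mul_distrib, Finset.prod_ite_eq', Finset.mem_univ, if_true]
    ring
  rw [Finset.sum_congr rfl fun e _ => h1 e]
  simp only [wedgeCoeff]
  rw [← det_sum_mul_eq_sum_det s (fun j e => chebCoeff e (chebS j * h))]
  have h2 : (∏ l ∈ Finset.univ.erase i, h.eval (b l)) =
      ∏ l, if l = i then 1 else h.eval (b l) := by
    rw [← Finset.mul_prod_erase _ _ (Finset.mem_univ i), if_pos rfl, one_mul]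
    exact Finset.prod_congr rfl fun l hl => by rw [if_neg (Finset.ne_of_mem_erase hl)]
  rw [h2, ← det_mul_column]
  congr 1
  ext l j
  have hexp := sum_chebCoeff (m + k) _ (degree_chebS_mul_lt hd j)
  rcases eq_or_ne l i with rfl | hl
  · simp only [hs, of_apply, if_true, updateRow_self, one_mul]
    conv_rhs => rw [hexp, map_sum, eval_finsetSum]
    refine Finset.sum_congr rfl fun e _ => ?_
    rw [← smul_eq_C_mul, map_smul, chebOp_chebS]
    simp
    ring
  · simp only [hs, of_apply, if_neg hl, updateRow_ne hl, one_mul]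
    rw [← eval_mul, mul_comm h]
    conv_rhs => rw [hexp, eval_finsetSum]
    exact Finset.sum_congr rfl fun e _ => by rw [eval_mul, eval_C, mul_comm]

lemma chebOp_mul_eval (p h : ℂ[X]) (c : ℂ) (hp : chebOp p = C c * p) (x : ℂ) :
    (chebOp (p * h)).eval x = (chebOp h).eval x * p.eval x +
      2 * (x ^ 2 - 4) * (derivative h).eval x * (derivative p).eval x +
      (c - 1) * h.eval x * p.eval x := by
  have h1 := congrArg (eval x) hp
  rw [chebOp_apply] at h1 ⊢
  rw [chebOp_apply]
  simp only [derivative_mul, derivative_add, eval_add, eval_mul, eval_sub, eval_pow, eval_X,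
    eval_C, eval_ofNat] at h1 ⊢
  linear_combination h.eval x * h1

lemma sum_sq_mul_wedgeCoeff_eq {h : ℂ[X]} (hd : h.natDegree = m) {b : Fin k → ℂ}
    (hb : Function.Injective b) (hh : ∀ i, h.eval (b i) ≠ 0) :
    ∑ e : Fin k → Fin (m + k), (∑ i, ((e i : ℂ) + 1) ^ 2) *
        ((∏ i, (chebS (e i)).eval (b i)) * wedgeCoeff h e) =
      (Matrix.of fun i j : Fin k => (chebS j).eval (b i)).det * (∏ i, h.eval (b i)) *
        (∑ i, (chebOp h).eval (b i) / h.eval (b i) +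
          2 * ∑ i, ∑ l ∈ Finset.univ.erase i,
            (b i ^ 2 - 4) * ((derivative h).eval (b i) / h.eval (b i)) * (b i - b l)⁻¹ +
          (∑ j : Fin k, ((j : ℂ) + 1) ^ 2 - k)) := by
  rw [sum_sq_mul_wedgeCoeff hd]
  set A : Matrix (Fin k) (Fin k) ℂ := Matrix.of fun i j : Fin k => (chebS j).eval (b i) with hA
  have hi : ∀ i, (∏ l ∈ Finset.univ.erase i, h.eval (b l)) *
      (A.updateRow i fun j => (chebOp (chebS j * h)).eval (b i)).det =
      A.det * (∏ i, h.eval (b i)) * ((chebOp h).eval (b i) / h.eval (b i) +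
        2 * (∑ l ∈ Finset.univ.erase i,
          (b i ^ 2 - 4) * ((derivative h).eval (b i) / h.eval (b i)) * (b i - b l)⁻¹) - 1) +
      (∏ i, h.eval (b i)) * (A.updateRow i fun j => ((j : ℂ) + 1) ^ 2 * A i j).det := by
    intro i
    have hrow : (fun j : Fin k => (chebOp (chebS j * h)).eval (b i)) =
        ((chebOp h).eval (b i) - h.eval (b i)) • A i +
        ((2 * (b i ^ 2 - 4) * (derivative h).eval (b i)) •
          (fun j : Fin k => (derivative (chebS j)).eval (b i)) +
        h.eval (b i) • fun j : Fin k => ((j : ℂ) + 1) ^ 2 * A i j) := by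
      funext j
      rw [chebOp_mul_eval _ _ _ (chebOp_chebS j)]
      simp only [Pi.add_apply, Pi.smul_apply, smul_eq_mul, hA, of_apply]
      ring
    rw [hrow, det_updateRow_add, det_updateRow_add, det_updateRow_smul, det_updateRow_smul,
      det_updateRow_smul, updateRow_eq_self, det_updateRow_derivative_chebS hb i, ← hA,
      ← Finset.mul_prod_erase _ (fun l => h.eval (b l)) (Finset.mem_univ i), ← Finset.mul_sum]
    have := hh i
    field_simp
    ring
  rw [Finset.sum_congr rfl fun i _ => hi i, Finset.sum_add_distrib, ← Finset.mul_sum,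
    ← Finset.mul_sum, sum_det_updateRow_mul, Finset.sum_sub_distrib, Finset.sum_add_distrib,
    ← Finset.mul_sum]
  simp
  ring

lemma wedgeCoeff_of_not_injective {n : ℕ} (h : ℂ[X]) {e : Fin k → Fin n}
    (he : ¬ Function.Injective e) : wedgeCoeff h e = 0 := by
  simp only [Function.Injective, not_forall] at he
  obtain ⟨i, i', hii, hne⟩ := he
  refine det_zero_of_row_eq hne ?_
  funext j
  simp [hii]

lemma wedgeCoeff_of_le {h : ℂ[X]} (hm : h.Monic) (hd : h.natDegree = m)
    {e : Fin k → Fin (m + k)} (he : ∀ i, m ≤ (e i : ℕ)) :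
    wedgeCoeff h e =
      (Matrix.of fun i j : Fin k => if (e i : ℕ) = m + j then (1 : ℂ) else 0).det := by
  have hdeg : ∀ j : Fin k, (chebS j * h).natDegree = m + j := fun j => by
    rw [(chebS_monic _).natDegree_mul hm, natDegree_chebS, hd, add_comm]
  have hU : (Matrix.of fun i j : Fin k => chebCoeff (m + i) (chebS j * h)).det = 1 := by
    rw [det_of_isUpperTriangular]
    · refine Finset.prod_eq_one fun j _ => ?_
      rw [of_apply, ← hdeg j, chebCoeff_natDegree]
      exact (chebS_monic _).mul hm
    · intro i j hlt
      refine chebCoeff_eq_zero _ _ (lt_of_le_of_lt degree_le_natDegree ?_)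
      rw [hdeg]
      have : (j : ℕ) < i := hlt
      exact_mod_cast (by omega : m + (j : ℕ) < m + i)
  have key : (Matrix.of fun i j : Fin k => chebCoeff (e i) (chebS j * h)) =
      (Matrix.of fun i j : Fin k => if (e i : ℕ) = m + j then (1 : ℂ) else 0) *
        Matrix.of fun i j : Fin k => chebCoeff (m + i) (chebS j * h) := by
    ext i j
    have h1 := he i
    have h2 := (e i).2
    rw [mul_apply, Finset.sum_eq_single ⟨(e i : ℕ) - m, by omega⟩]
    · simp [Nat.add_sub_cancel' h1]
    · intro l _ hl
      rw [of_apply, if_neg, zero_mul]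
      intro h3
      exact hl (Fin.ext (by simp [h3]))
    · simp
  rw [wedgeCoeff, key, det_mul, hU, mul_one]

/-- A mean of the coefficients `wedgeCoeff` which is an eigenvector for the top eigenvalue is
concentrated on the top monomials. -/
lemma eq_det_of_eigen {Hc : (Fin k → Fin (m + k)) → ℂ}
    (h0 : ∀ e, ¬ Function.Injective e → Hc e = 0)
    (h1 : ∀ e, (∀ i, m ≤ (e i : ℕ)) →
      Hc e = (Matrix.of fun i j : Fin k => if (e i : ℕ) = m + j then (1 : ℂ) else 0).det)
    (h2 : ∀ e, (∑ i, ((e i : ℂ) + 1) ^ 2 - ∑ j : Fin k, ((m : ℂ) + j + 1) ^ 2) * Hc e = 0)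
    (b : Fin k → ℂ) :
    ∑ e : Fin k → Fin (m + k), (∏ i, (chebS (e i)).eval (b i)) * Hc e =
      (Matrix.of fun i j : Fin k => (chebS (m + j)).eval (b i)).det := by
  have hall : ∀ e, Hc e =
      (Matrix.of fun i j : Fin k => if (e i : ℕ) = m + j then (1 : ℂ) else 0).det := by
    intro e
    by_cases hge : ∀ i, m ≤ (e i : ℕ)
    · exact h1 e hge
    · have hz : (Matrix.of fun i j : Fin k => if (e i : ℕ) = m + j then (1 : ℂ) else 0).det = 0 := by
        push Not at hge
        obtain ⟨i, hi⟩ := hge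
        refine det_eq_zero_of_row_eq_zero i fun j => ?_
        rw [of_apply, if_neg (by omega)]
      rw [hz]
      by_cases hinj : Function.Injective e
      · rcases mul_eq_zero.1 (h2 e) with h | h
        · refine absurd (fun i => image_eq_of_sum_sq_eq e hinj ?_ i) hge
          rw [sub_eq_zero] at h
          exact_mod_cast h
        · exact h
      · exact h0 e hinj
  simp only [hall]
  rw [← det_sum_mul_eq_sum_det (fun i (e : Fin (m + k)) => (chebS e).eval (b i))
    (fun j e => if (e : ℕ) = m + j then 1 else 0)]
  congr 1
  ext i j
  rw [of_apply, of_apply, Finset.sum_eq_single ⟨m + j, by omega⟩]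
  · simp
  · intro e _ he
    rw [if_neg fun h => he (Fin.ext h), mul_zero]
  · simp

end AlternatingExpansion

section Palindromic

open Polynomial

/-- If `p` is palindromic of degree `2m`, then `p x = x ^ m * (foldPoly m p) (x + x⁻¹)`. -/
noncomputable def foldPoly (m : ℕ) (p : ℂ[X]) : ℂ[X] :=
  C (p.coeff m) + ∑ n ∈ Finset.range m, C (p.coeff (m - (n + 1))) * dickson 1 1 (n + 1)

lemma dickson_one_one_monic_natDegree (n : ℕ) :
    (dickson 1 (1 : ℂ) (n + 1)).Monic ∧ (dickson 1 (1 : ℂ) (n + 1)).natDegree = n + 1 := by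
  induction n using Nat.strong_induction_on with
  | _ n ih =>
    match n, ih with
    | 0, _ => simp [monic_X]
    | n + 1, ih =>
      obtain ⟨h1, h2⟩ := ih n (by omega)
      have hM : (X * dickson 1 (1 : ℂ) (n + 1)).Monic := monic_X.mul h1
      have hD : (X * dickson 1 (1 : ℂ) (n + 1)).natDegree = n + 2 := by
        rw [monic_X.natDegree_mul h1, h2, natDegree_X]; ring
      have hlt : (dickson 1 (1 : ℂ) n).degree < (X * dickson 1 (1 : ℂ) (n + 1)).degree := by
        rw [degree_eq_natDegree hM.ne_zero, hD]
        refine lt_of_le_of_lt degree_le_natDegree ?_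
        have : (dickson 1 (1 : ℂ) n).natDegree ≤ n := by
          cases n with
          | zero =>
            rw [dickson_zero, show ((3 : ℂ[X]) - ((1 : ℕ) : ℂ[X])) = C 2 by
              rw [C_ofNat]; norm_num, natDegree_C]
          | succ n => exact (ih n (by omega)).2.le
        exact_mod_cast (by omega : _ < n + 2)
      rw [dickson_add_two, C_1, one_mul]
      exact ⟨hM.sub_of_left hlt, 
        by rw [natDegree_eq_of_degree_eq (degree_sub_eq_left_of_degree_lt hlt), hD]⟩

lemma foldPoly_monic_natDegree (m : ℕ) {p : ℂ[X]} (hp : p.coeff 0 = 1) :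
    (foldPoly m p).Monic ∧ (foldPoly m p).natDegree = m := by
  cases m with
  | zero => simp [foldPoly, hp]
  | succ m =>
    obtain ⟨h1, h2⟩ := dickson_one_one_monic_natDegree m
    have h : foldPoly (m + 1) p = (C (p.coeff (m + 1)) + ∑ n ∈ Finset.range m,
        C (p.coeff (m + 1 - (n + 1))) * dickson 1 1 (n + 1)) + dickson 1 (1 : ℂ) (m + 1) := by
      rw [foldPoly, Finset.sum_range_succ, Nat.sub_self, hp, C_1, one_mul, add_assoc]
    have hlt : (C (p.coeff (m + 1)) + ∑ n ∈ Finset.range m,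
        C (p.coeff (m + 1 - (n + 1))) * dickson 1 1 (n + 1)).degree <
          (dickson 1 (1 : ℂ) (m + 1)).degree := by
      rw [degree_eq_natDegree h1.ne_zero, h2]
      refine lt_of_le_of_lt (degree_add_le _ _) (max_lt ?_ ?_)
      · exact lt_of_le_of_lt degree_C_le (by exact_mod_cast Nat.succ_pos m)
      · refine lt_of_le_of_lt (degree_sum_le _ _) ?_
        rw [Finset.sup_lt_iff (by exact_mod_cast WithBot.bot_lt_coe _)]
        intro n hn
        refine lt_of_le_of_lt degree_le_natDegree ?_
        have := natDegree_C_mul_le (p.coeff (m + 1 - (n + 1))) (dickson 1 (1 : ℂ) (n + 1))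
        rw [(dickson_one_one_monic_natDegree n).2] at this
        have hn := Finset.mem_range.1 hn
        exact_mod_cast (by omega : _ < m + 1)
    rw [h]
    exact ⟨h1.add_of_right hlt, 
      by rw [natDegree_eq_of_degree_eq (degree_add_eq_right_of_degree_lt hlt), h2]⟩

lemma eval_foldPoly {m : ℕ} {p : ℂ[X]} (hd : p.natDegree = 2 * m) (hr : p.reverse = p)
    {x : ℂ} (hx : x ≠ 0) : x ^ m * (foldPoly m p).eval (x + x⁻¹) = p.eval x := by
  have hc : ∀ n < m, p.coeff (m + (n + 1)) = p.coeff (m - (n + 1)) := by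
    intro n hn
    conv_lhs => rw [← hr, coeff_reverse, hd, revAt_le (by omega)]
    congr 1
    omega
  have hsum : p.eval x = ∑ j ∈ Finset.range (m + (m + 1)), p.coeff j * x ^ j := by
    rw [eval_eq_sum_range, hd]
    congr 2
    omega
  rw [hsum, Finset.sum_range_add, Finset.sum_range_succ', ← Finset.sum_range_reflect, foldPoly,
    eval_add, eval_C, eval_finsetSum, mul_add, Finset.mul_sum, add_comm, ← add_assoc,
    ← Finset.sum_add_distrib]
  congr 1
  · refine Finset.sum_congr rfl fun n hn => ?_
    have hn := Finset.mem_range.1 hn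
    rw [eval_mul, eval_C, dickson_one_one_eval_add_inv x x⁻¹ (mul_inv_cancel₀ hx), hc n hn,
      show m - 1 - n = m - (n + 1) by omega]
    have h1 : x ^ m * x⁻¹ ^ (n + 1) = x ^ (m - (n + 1)) := by
      rw [inv_pow, pow_sub₀ x hx (by omega)]
    linear_combination p.coeff (m - (n + 1)) * h1
  · simp [mul_comm]

variable {m : ℕ} {M : Matrix (Fin m ⊕ Fin m) (Fin m ⊕ Fin m) ℂ}

lemma reverse_charpoly_of_mem_symplecticGroup (hM : M ∈ symplecticGroup (Fin m) ℂ) :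
    M.charpoly.reverse = M.charpoly := by
  have hdet := SymplecticGroup.det_eq_one hM
  have h1 : M⁻¹.charpoly = M.charpolyRev := by
    rw [charpoly_inv _ ((isUnit_iff_isUnit_det _).2 (by simp [hdet])), hdet]
    simp
  have h2 : M⁻¹.charpoly = M.charpoly := by
    have h3 := SymplecticGroup.inv_eq_symplectic_inv M hM
    rw [h3, mul_assoc, charpoly_mul_comm, mul_assoc, mul_neg, J_squared, neg_neg, mul_one,
      charpoly_transpose]
  rw [reverse_charpoly, ← h1, h2]

lemma foldPoly_charpoly_monic_natDegree (hM : M ∈ symplecticGroup (Fin m) ℂ) :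
    (foldPoly m M.charpoly).Monic ∧ (foldPoly m M.charpoly).natDegree = m := by
  refine foldPoly_monic_natDegree m ?_
  rw [← reverse_charpoly_of_mem_symplecticGroup hM, coeff_zero_reverse, M.charpoly_monic]

lemma det_one_sub_smul_eq (hM : M ∈ symplecticGroup (Fin m) ℂ) {x : ℂ} (hx : x ≠ 0) :
    (1 - x • M).det = x ^ m * (foldPoly m M.charpoly).eval (x + x⁻¹) := by
  have hr := reverse_charpoly_of_mem_symplecticGroup hM
  rw [eval_foldPoly (by simp [two_mul]) hr hx, ← hr, reverse_charpoly, charpolyRev,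
    ← coe_evalRingHom, RingHom.map_det]
  congr 1
  ext i j
  simp [one_apply, apply_ite, mul_comm x]

end Palindromic

section Derivatives

open scoped Matrix.Norms.L2Operator

variable {n : Type*} [Fintype n] [DecidableEq n]

lemma HasDerivAt.matrix_linearMap (l : Matrix n n ℂ →ₗ[ℂ] ℂ)
    {N : ℂ → Matrix n n ℂ} {N' : Matrix n n ℂ} {t : ℂ} (h : HasDerivAt N N' t) :
    HasDerivAt (fun s => l (N s)) (l N') t :=
  l.toContinuousLinearMap.hasFDerivAt.comp_hasDerivAt t h

/-- Jacobi's formula. -/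
lemma HasDerivAt.matrix_det {N : ℂ → Matrix n n ℂ} {N' : Matrix n n ℂ} {t : ℂ}
    (hN : HasDerivAt N N' t) :
    HasDerivAt (fun s => (N s).det) ((N t).adjugate * N').trace t := by
  have h : ∀ i j, HasDerivAt (fun s => N s i j) (N' i j) t := fun i j =>
    hN.matrix_linearMap (entryLinearMap ℂ ℂ i j)
  have h1 : ∀ σ : Equiv.Perm n, HasDerivAt
      (fun s => ((Equiv.Perm.sign σ : ℤ) : ℂ) * ∏ i, N s (σ i) i)
      (((Equiv.Perm.sign σ : ℤ) : ℂ) *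
        ∑ i, (∏ j ∈ Finset.univ.erase i, N t (σ j) j) • N' (σ i) i) t :=
    fun σ => (HasDerivAt.fun_finsetProd fun i _ => h (σ i) i).const_mul _
  have h2 := HasDerivAt.fun_sum (u := Finset.univ) fun σ _ => h1 σ
  rw [show (fun s => (N s).det) = fun s => ∑ σ : Equiv.Perm n,
    ((Equiv.Perm.sign σ : ℤ) : ℂ) * ∏ i, N s (σ i) i from funext fun s => det_apply' _]
  refine h2.congr_deriv ?_
  symm
  simp only [Finset.mul_sum]
  rw [Finset.sum_comm, trace]
  refine Finset.sum_congr rfl fun i _ => ?_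
  have h3 : ((N t).adjugate * N').diag i = ((N t).updateCol i fun l => N' l i).det := by
    rw [← cramer_apply, cramer_eq_adjugate_mulVec, diag_apply, mul_apply]
    rfl
  rw [h3, det_apply']
  refine Finset.sum_congr rfl fun σ _ => ?_
  rw [← Finset.mul_prod_erase _ _ (Finset.mem_univ i), updateCol_self, smul_eq_mul,
    mul_comm (N' _ _)]
  congr 2
  exact Finset.prod_congr rfl fun j hj => updateCol_ne (Finset.ne_of_mem_erase hj)

lemma HasDerivAt.matrix_inv {N : ℂ → Matrix n n ℂ} {N' : Matrix n n ℂ} {t : ℂ}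
    (h : HasDerivAt N N' t) (hN : (N t).det ≠ 0) :
    HasDerivAt (fun s => (N s)⁻¹) (-((N t)⁻¹ * N' * (N t)⁻¹)) t := by
  obtain ⟨x, hx⟩ := (isUnit_iff_isUnit_det (N t)).2 hN.isUnit
  have h1 := hasFDerivAt_ringInverse (𝕜 := ℂ) x
  rw [hx] at h1
  have h2 := h1.comp_hasDerivAt t h
  have h3 : ((x⁻¹ : (Matrix n n ℂ)ˣ) : Matrix n n ℂ) = (N t)⁻¹ := by
    rw [← hx, coe_units_inv]
  have h4 : (fun s => (N s)⁻¹) = Ring.inverse ∘ N := by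
    funext s
    exact nonsing_inv_eq_ringInverse _
  rw [h4]
  simpa [h3] using h2

/-- The resolvent of `u`, as a power series in the parameter `a`. -/
noncomputable def resolv (a : ℂ) (u : Matrix n n ℂ) : Matrix n n ℂ := (1 - a • u)⁻¹

variable {a : ℂ} {u : Matrix n n ℂ}

lemma smul_mul_resolv (h : (1 - a • u).det ≠ 0) : (a • u) * resolv a u = resolv a u - 1 := by
  have := mul_nonsing_inv (1 - a • u) h.isUnit
  rw [sub_mul, one_mul] at this
  rw [resolv]
  nth_rw 3 [← this]
  abel

lemma resolv_mul_smul (h : (1 - a • u).det ≠ 0) : resolv a u * (a • u) = resolv a u - 1 := by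
  have := nonsing_inv_mul (1 - a • u) h.isUnit
  rw [mul_sub, mul_one] at this
  rw [resolv]
  nth_rw 3 [← this]
  abel

lemma adjugate_eq_det_smul_resolv (h : (1 - a • u).det ≠ 0) :
    (1 - a • u).adjugate = (1 - a • u).det • resolv a u := by
  rw [resolv, inv_def, smul_smul, Ring.mul_inverse_cancel _ h.isUnit, one_smul]

variable {U : ℂ → Matrix n n ℂ} {X : Matrix n n ℂ} {t : ℂ}

lemma hasDerivAt_det_one_sub_smul (hU : HasDerivAt U (X * U t) t) (hX : X.trace = 0)
    (h : (1 - a • U t).det ≠ 0) :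
    HasDerivAt (fun s => (1 - a • U s).det)
      (-((1 - a • U t).det * (resolv a (U t) * X).trace)) t := by
  have h1 : HasDerivAt (fun s => 1 - a • U s) (-(a • (X * U t))) t :=
    (hU.const_smul a).const_sub 1
  refine h1.matrix_det.congr_deriv ?_
  rw [adjugate_eq_det_smul_resolv h, mul_neg, trace_neg, smul_mul_assoc, trace_smul,
    smul_eq_mul, ← mul_smul_comm, ← mul_assoc, trace_mul_comm _ (a • U t), ← mul_assoc,
    smul_mul_resolv h, sub_mul, one_mul, trace_sub, hX, sub_zero]

lemma hasDerivAt_resolv (hU : HasDerivAt U (X * U t) t) (h : (1 - a • U t).det ≠ 0) :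
    HasDerivAt (fun s => resolv a (U s))
      (resolv a (U t) * X * (resolv a (U t) - 1)) t := by
  have h1 : HasDerivAt (fun s => 1 - a • U s) (-(a • (X * U t))) t :=
    (hU.const_smul a).const_sub 1
  refine (h1.matrix_inv h).congr_deriv ?_
  rw [← smul_mul_resolv h, resolv, mul_neg, neg_mul, neg_neg, ← mul_smul_comm]
  simp only [mul_assoc]

lemma hasDerivAt_det_one_sub_smul_param (h : (1 - a • u).det ≠ 0) :
    HasDerivAt (fun s : ℂ => (1 - s • u).det)
      (-((1 - a • u).det * (resolv a u * u).trace)) a := by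
  have h1 : HasDerivAt (fun s : ℂ => 1 - s • u) (-u) a := by
    simpa using ((hasDerivAt_id a).smul_const u).const_sub 1
  refine h1.matrix_det.congr_deriv ?_
  rw [adjugate_eq_det_smul_resolv h, mul_neg, trace_neg, smul_mul_assoc, trace_smul, smul_eq_mul]

lemma hasDerivAt_resolv_param (h : (1 - a • u).det ≠ 0) :
    HasDerivAt (fun s : ℂ => resolv s u) (resolv a u * u * resolv a u) a := by
  have h1 : HasDerivAt (fun s : ℂ => 1 - s • u) (-u) a := by
    simpa using ((hasDerivAt_id a).smul_const u).const_sub 1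
  refine (h1.matrix_inv h).congr_deriv ?_
  simp [resolv]

end Derivatives

section Casimir

variable {m : ℕ}

/-- The adjoint of a matrix with respect to the standard symplectic form. -/
noncomputable def dag (M : Matrix (Fin m ⊕ Fin m) (Fin m ⊕ Fin m) ℂ) :
    Matrix (Fin m ⊕ Fin m) (Fin m ⊕ Fin m) ℂ :=
  -(J (Fin m) ℂ * Mᵀ * J (Fin m) ℂ)

variable (M N : Matrix (Fin m ⊕ Fin m) (Fin m ⊕ Fin m) ℂ)

lemma J_mul_J_mul : J (Fin m) ℂ * (J (Fin m) ℂ * M) = -M := by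
  rw [← mul_assoc, J_squared, neg_mul, one_mul]

lemma dag_one : dag (1 : Matrix (Fin m ⊕ Fin m) (Fin m ⊕ Fin m) ℂ) = 1 := by
  simp [dag, J_squared]

lemma dag_sub : dag (M - N) = dag M - dag N := by
  simp only [dag, transpose_sub, mul_sub, sub_mul]
  abel

lemma dag_smul (c : ℂ) : dag (c • M) = c • dag M := by
  simp [dag]

lemma dag_mul : dag (M * N) = dag N * dag M := by
  rw [dag, dag, dag, neg_mul_neg, transpose_mul]
  simp only [mul_assoc, J_mul_J_mul, mul_neg]

lemma dag_dag : dag (dag M) = M := by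
  simp only [dag, transpose_neg, transpose_mul, transpose_transpose, J_transpose, mul_assoc,
    neg_mul, mul_neg, neg_neg, J_mul_J_mul, J_squared, mul_one]

lemma trace_dag : (dag M).trace = M.trace := by
  rw [dag, trace_neg, trace_mul_comm, ← mul_assoc, J_squared, neg_mul, one_mul, trace_neg,
    trace_transpose, neg_neg]

lemma trace_mul_dag : (M * dag N).trace = (dag M * N).trace := by
  rw [← trace_dag, dag_mul, dag_dag, trace_mul_comm]

/-- Elements spanning the symplectic Lie algebra. -/
noncomputable def spGen (p q : Fin m ⊕ Fin m) : Matrix (Fin m ⊕ Fin m) (Fin m ⊕ Fin m) ℂ :=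
  single p q 1 - dag (single p q 1)

lemma dag_spGen (p q : Fin m ⊕ Fin m) : dag (spGen p q) = -spGen p q := by
  rw [spGen, dag_sub, dag_dag, neg_sub]

lemma trace_mul_single_one {n : Type*} [Fintype n] [DecidableEq n] (A : Matrix n n ℂ) (p q : n) :
    (A * single p q 1).trace = A q p := by
  simp [trace_mul_single]

lemma sum_trace_mul_spGen_mul :
    ∑ p, ∑ q, (M * spGen p q).trace * (N * single q p 1).trace = ((M - dag M) * N).trace := by
  rw [Finset.sum_comm, trace]
  refine Finset.sum_congr rfl fun q _ => ?_
  rw [diag_apply, mul_apply]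
  refine Finset.sum_congr rfl fun p _ => ?_
  rw [spGen, mul_sub, trace_sub, trace_mul_dag, trace_mul_single_one, trace_mul_single_one,
    trace_mul_single_one, Matrix.sub_apply]

lemma mul_single_one_mul_apply {n : Type*} [Fintype n] [DecidableEq n] (A B : Matrix n n ℂ)
    (p q i j : n) : (A * (single p q 1 : Matrix n n ℂ) * B) i j = A i p * B q j := by
  rw [mul_apply, Finset.sum_eq_single q]
  · simp
  · intro l _ hl
    simp [mul_single_apply_of_ne _ _ _ _ _ hl]
  · simp

lemma sum_trace_mul_spGen_mul_mul :
    ∑ p, ∑ q, (M * spGen p q * N * single q p 1).trace =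
      M.trace * N.trace + (M * dag N).trace := by
  have h : ∀ p q, (M * spGen p q * N * single q p 1).trace =
      M p p * N q q + (M * J (Fin m) ℂ) p q * (J (Fin m) ℂ * N) p q := by
    intro p q
    have h1 : M * spGen p q * N = M * single p q 1 * N +
        M * J (Fin m) ℂ * single q p 1 * (J (Fin m) ℂ * N) := by
      simp only [spGen, dag, transpose_single, sub_neg_eq_add, mul_add, add_mul, mul_assoc]
    rw [trace_mul_single_one, h1, Matrix.add_apply, mul_single_one_mul_apply, mul_single_one_mul_apply]
  simp only [h, Finset.sum_add_distrib]
  congr 1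
  · rw [trace, trace, Finset.sum_mul_sum]
    rfl
  · have h2 : M * dag N = M * J (Fin m) ℂ * (J (Fin m) ℂ * N)ᵀ := by
      rw [dag, transpose_mul, J_transpose]
      simp only [mul_neg, mul_assoc]
    rw [h2, trace]
    refine Finset.sum_congr rfl fun p _ => ?_
    rw [diag_apply, Matrix.mul_apply]
    rfl

lemma sum_casimir {k : ℕ} (R : Fin k → Matrix (Fin m ⊕ Fin m) (Fin m ⊕ Fin m) ℂ) :
    ∑ p, ∑ q, ((∑ i, (R i * spGen p q).trace) * (∑ j, (R j * single q p 1).trace) -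
        ∑ i, (R i * spGen p q * (R i - 1) * single q p 1).trace) =
      ∑ i, ∑ j, ((R i - dag (R i)) * R j).trace -
        ∑ i, ((R i).trace * (R i - 1).trace + (R i * (dag (R i) - 1)).trace) := by
  have h1 : ∀ i, (R i).trace * (R i - 1).trace + (R i * (dag (R i) - 1)).trace =
      ∑ p, ∑ q, (R i * spGen p q * (R i - 1) * single q p 1).trace := fun i => by
    rw [sum_trace_mul_spGen_mul_mul, dag_sub, dag_one]
  simp only [Finset.sum_sub_distrib, Finset.sum_mul_sum, h1, ← sum_trace_mul_spGen_mul]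
  congr 1
  · simp only [Finset.sum_comm (s := (Finset.univ : Finset (Fin m ⊕ Fin m)))
      (t := (Finset.univ : Finset (Fin k)))]
  · simp only [Finset.sum_comm (s := (Finset.univ : Finset (Fin m ⊕ Fin m)))
      (t := (Finset.univ : Finset (Fin k)))]

end Casimir

section ResolventTraces

open Polynomial
open scoped Matrix.Norms.L2Operator

variable {m : ℕ} {u : Matrix (Fin m ⊕ Fin m) (Fin m ⊕ Fin m) ℂ}

lemma trace_resolv_mul_resolv {n : Type*} [Fintype n] [DecidableEq n] {u : Matrix n n ℂ} {a c : ℂ}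
    (ha : (1 - a • u).det ≠ 0) (hc : (1 - c • u).det ≠ 0) :
    (a - c) * (resolv a u * resolv c u).trace =
      a * (resolv a u).trace - c * (resolv c u).trace := by
  have h1 : resolv a u - resolv a u * (a • u) = 1 := by rw [resolv_mul_smul ha, sub_sub_cancel]
  have h2 : resolv c u - (c • u) * resolv c u = 1 := by rw [smul_mul_resolv hc, sub_sub_cancel]
  have h3 : resolv c u = resolv a u * resolv c u - a • (resolv a u * u * resolv c u) := by
    conv_lhs => rw [← one_mul (resolv c u), ← h1, sub_mul, mul_smul_comm, smul_mul_assoc]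
  have h4 : resolv a u = resolv a u * resolv c u - c • (resolv a u * u * resolv c u) := by
    conv_lhs => rw [← mul_one (resolv a u), ← h2, mul_sub, smul_mul_assoc, mul_smul_comm,
      ← mul_assoc]
  have h5 := congrArg trace h3
  have h6 := congrArg trace h4
  rw [trace_sub, trace_smul, smul_eq_mul] at h5 h6
  linear_combination c * h5 - a * h6

lemma dag_mul_self_of_mem (hu : u ∈ symplecticGroup (Fin m) ℂ) : dag u * u = 1 := by
  rw [dag, neg_mul]
  exact SymplecticGroup.inv_left_mul_aux hu

lemma trace_dag_resolv_mul_resolv (hu : u ∈ symplecticGroup (Fin m) ℂ) {a c : ℂ}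
    (ha : (1 - a • u).det ≠ 0) (hc : (1 - c • u).det ≠ 0) :
    (1 - a * c) * (dag (resolv a u) * resolv c u).trace =
      (resolv a u).trace + (resolv c u).trace - 2 * m := by
  have h2 : dag (resolv a u) * (a • dag u) = dag (resolv a u) - 1 := by
    rw [← dag_smul, ← dag_mul, smul_mul_resolv ha, dag_sub, dag_one]
  have h3 := smul_mul_resolv hc
  have h4 : (dag (resolv a u) - 1) * (resolv c u - 1) =
      (a * c) • (dag (resolv a u) * resolv c u) := by
    rw [← h2, ← h3]
    simp only [smul_mul_assoc, mul_smul_comm, smul_smul]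
    rw [mul_assoc, ← mul_assoc (dag u), dag_mul_self_of_mem hu, one_mul, mul_comm c]
  have h5 := congrArg trace h4
  rw [sub_mul, mul_sub, one_mul, mul_one, trace_sub, trace_sub, trace_sub, trace_smul, trace_one,
    trace_dag, smul_eq_mul, Fintype.card_sum, Fintype.card_fin] at h5
  push_cast at h5
  linear_combination h5

lemma hasDerivAt_add_inv {a : ℂ} (ha : a ≠ 0) :
    HasDerivAt (fun s : ℂ => s + s⁻¹) (1 - (a ^ 2)⁻¹) a := by
  refine ((hasDerivAt_id' a).fun_add (hasDerivAt_inv ha)).congr_deriv ?_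
  ring

lemma trace_resolv (hu : u ∈ symplecticGroup (Fin m) ℂ) {a : ℂ} (ha : a ≠ 0)
    (hd : (1 - a • u).det ≠ 0) :
    (resolv a u).trace = m + (a⁻¹ - a) *
      ((derivative (foldPoly m u.charpoly)).eval (a + a⁻¹) /
        (foldPoly m u.charpoly).eval (a + a⁻¹)) := by
  set h := foldPoly m u.charpoly with hh
  have hev := det_one_sub_smul_eq hu ha
  rw [← hh] at hev
  have h0 : h.eval (a + a⁻¹) ≠ 0 := fun h0 => hd (by rw [hev, h0, mul_zero])
  have h1 : HasDerivAt (fun s : ℂ => s ^ m * h.eval (s + s⁻¹))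
      (m * a ^ (m - 1) * h.eval (a + a⁻¹) +
        a ^ m * ((derivative h).eval (a + a⁻¹) * (1 - (a ^ 2)⁻¹))) a :=
    (hasDerivAt_pow m a).mul ((h.hasDerivAt _).comp a (hasDerivAt_add_inv ha))
  have h2 : (fun s : ℂ => (1 - s • u).det) =ᶠ[nhds a] fun s => s ^ m * h.eval (s + s⁻¹) := by
    filter_upwards [isOpen_ne.mem_nhds ha] with s hs using det_one_sub_smul_eq hu hs
  have h3 := (hasDerivAt_det_one_sub_smul_param hd).unique (h1.congr_of_eventuallyEq h2)
  have h4 : a * (resolv a u * u).trace = (resolv a u).trace - 2 * m := by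
    rw [← smul_eq_mul, ← trace_smul, ← mul_smul_comm, resolv_mul_smul hd, trace_sub, trace_one]
    simp [two_mul]
  have h5 : (m : ℂ) * a ^ (m - 1) * a = m * a ^ m := by
    rcases m.eq_zero_or_pos with hm | hm
    · simp [hm]
    · rw [mul_assoc, pow_sub_one_mul hm.ne']
  rw [hev] at h3
  have h6 : a ^ m ≠ 0 := pow_ne_zero _ ha
  have h7 : a ^ m * h.eval (a + a⁻¹) * ((resolv a u).trace - 2 * m) =
      - (m * a ^ m * h.eval (a + a⁻¹) +
        a ^ m * ((derivative h).eval (a + a⁻¹) * (a - a⁻¹))) := by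
    have h8 : a * (1 - (a ^ 2)⁻¹) = a - a⁻¹ := by field_simp
    rw [← h4, ← h5, ← h8]
    linear_combination -a * h3
  have h9 : h.eval (a + a⁻¹) * ((resolv a u).trace - 2 * m) =
      - (m * h.eval (a + a⁻¹) + (derivative h).eval (a + a⁻¹) * (a - a⁻¹)) := by
    apply mul_left_cancel₀ h6
    linear_combination h7
  generalize h.eval (a + a⁻¹) = x at h0 h9 ⊢
  generalize (derivative h).eval (a + a⁻¹) = y at h9 ⊢
  rw [← sub_eq_zero] at h9 ⊢
  rw [← mul_right_inj' h0, mul_zero, ← h9]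
  field_simp
  ring

lemma trace_resolv_mul_self (hu : u ∈ symplecticGroup (Fin m) ℂ) {a : ℂ} (ha : a ≠ 0)
    (hd : (1 - a • u).det ≠ 0) {h : ℂ[X]} (hh : h = foldPoly m u.charpoly) :
    (resolv a u * resolv a u).trace = (resolv a u).trace -
      (a + a⁻¹) * ((derivative h).eval (a + a⁻¹) / h.eval (a + a⁻¹)) -
      (a⁻¹ - a) ^ 2 * ((derivative (derivative h)).eval (a + a⁻¹) / h.eval (a + a⁻¹) -
        ((derivative h).eval (a + a⁻¹) / h.eval (a + a⁻¹)) ^ 2) := by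
  have hev := det_one_sub_smul_eq hu ha
  rw [← hh] at hev
  have h0 : h.eval (a + a⁻¹) ≠ 0 := fun h0 => hd (by rw [hev, h0, mul_zero])
  have hb := hasDerivAt_add_inv ha
  set b := a + a⁻¹ with hb_def
  have h1 : HasDerivAt (fun s : ℂ => m + (s⁻¹ - s) *
      ((derivative h).eval (s + s⁻¹) / h.eval (s + s⁻¹)))
      ((-(a ^ 2)⁻¹ - 1) * ((derivative h).eval b / h.eval b) + (a⁻¹ - a) *
        (((derivative (derivative h)).eval b * (1 - (a ^ 2)⁻¹) * h.eval b -
          (derivative h).eval b * ((derivative h).eval b * (1 - (a ^ 2)⁻¹))) / h.eval b ^ 2)) a :=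
    (((hasDerivAt_inv ha).sub (hasDerivAt_id a)).mul
      ((((derivative h).hasDerivAt _).comp a hb).div ((h.hasDerivAt _).comp a hb) h0)).const_add _
  have hcont : Continuous fun s : ℂ => (1 - s • u).det := by fun_prop
  have h2 := (hasDerivAt_resolv_param hd).matrix_linearMap (traceLinearMap _ ℂ ℂ)
  have h3 : (fun s : ℂ => (resolv s u).trace) =ᶠ[nhds a] fun s : ℂ => m + (s⁻¹ - s) *
      ((derivative h).eval (s + s⁻¹) / h.eval (s + s⁻¹)) := by
    filter_upwards [isOpen_ne.mem_nhds ha, hcont.continuousAt.eventually_ne hd] with s hs hs'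
    rw [trace_resolv hu hs hs', hh]
  have h4 := h2.unique (h1.congr_of_eventuallyEq h3)
  have h5 : a * (resolv a u * u * resolv a u).trace =
      (resolv a u * resolv a u).trace - (resolv a u).trace := by
    rw [← smul_eq_mul, ← trace_smul, ← smul_mul_assoc, ← mul_smul_comm, resolv_mul_smul hd, sub_mul,
      one_mul, trace_sub]
  rw [traceLinearMap_apply] at h4
  rw [h4] at h5
  generalize h.eval b = x at h0 h5 ⊢
  generalize (derivative h).eval b = y at h5 ⊢
  generalize (derivative (derivative h)).eval b = z at h5 ⊢
  rw [sub_sub, ← sub_eq_zero, sub_sub_eq_add_sub, add_sub_right_comm, ← h5, hb_def]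
  field_simp
  ring

variable {k : ℕ} {a : Fin k → ℂ}

/-- The Casimir element of the symplectic Lie algebra acts on `∏ i, det (1 - a i • u)`, up to
conjugation by a Vandermonde determinant and an additive constant, as `∑ i, chebOp` in the
variables `a i + (a i)⁻¹`. -/
lemma sum_trace_resolv_eq (hu : u ∈ symplecticGroup (Fin m) ℂ) (ha : ∀ i, a i ≠ 0)
    (hinj : Function.Injective a) (hne : ∀ i j, a i * a j ≠ 1) (hd : ∀ i, (1 - a i • u).det ≠ 0)
    {b : Fin k → ℂ} (hb : ∀ i, b i = a i + (a i)⁻¹) {h : ℂ[X]} (hh : h = foldPoly m u.charpoly) :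
    ∑ i, ∑ j, ((resolv (a i) u - dag (resolv (a i) u)) * resolv (a j) u).trace -
        ∑ i, ((resolv (a i) u).trace * (resolv (a i) u - 1).trace +
          (resolv (a i) u * (dag (resolv (a i) u) - 1)).trace) =
      -(∑ i, (chebOp h).eval (b i) / h.eval (b i) +
          2 * ∑ i, ∑ l ∈ Finset.univ.erase i,
            (b i ^ 2 - 4) * ((derivative h).eval (b i) / h.eval (b i)) * (b i - b l)⁻¹ -
          k * (m + 1) ^ 2 - k * (k - 1) * m) := by
  set q : Fin k → ℂ := fun i => (derivative h).eval (b i) / h.eval (b i) with hq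
  have htr : ∀ i, (resolv (a i) u).trace = m + ((a i)⁻¹ - a i) * q i := fun i => by
    simp only [trace_resolv hu (ha i) (hd i), ← hh, hq, hb]
  have hd' : ∀ i, ((resolv (a i) u - dag (resolv (a i) u)) * resolv (a i) u).trace -
      ((resolv (a i) u).trace * (resolv (a i) u - 1).trace +
          (resolv (a i) u * (dag (resolv (a i) u) - 1)).trace) =
      -((chebOp h).eval (b i) / h.eval (b i) - (m + 1) ^ 2) := by
    intro i
    have h0 := ha i
    have h1 : h.eval (b i) ≠ 0 := fun h1 => hd i (by
      rw [det_one_sub_smul_eq hu h0, ← hh, ← hb, h1, mul_zero])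
    have h2 := trace_resolv_mul_self hu h0 (hd i) hh
    rw [← hb, show (derivative h).eval (b i) / h.eval (b i) = q i from rfl] at h2
    have h3 := trace_dag_resolv_mul_resolv hu (hd i) (hd i)
    have h4 : (chebOp h).eval (b i) / h.eval (b i) =
        ((a i)⁻¹ - a i) ^ 2 * ((derivative (derivative h)).eval (b i) / h.eval (b i)) +
          3 * b i * q i + 1 := by
      have h5 : b i ^ 2 - 4 = ((a i)⁻¹ - a i) ^ 2 := by
        rw [hb]
        field_simp
        ring
      simp only [chebOp_apply, eval_add, eval_mul, eval_sub, eval_pow, eval_X, eval_ofNat, h5, hq]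
      field_simp
    have h6 : (dag (resolv (a i) u) * resolv (a i) u).trace = 2 * (a i)⁻¹ * q i := by
      apply mul_left_cancel₀ (sub_ne_zero.2 (hne i i).symm)
      rw [h3, htr]
      field_simp
      ring
    rw [sub_mul, mul_sub, mul_one, trace_sub, trace_sub, trace_sub, trace_mul_dag, h2, h6, h4,
      trace_one, htr, hb]
    simp only [Fintype.card_sum, Fintype.card_fin, Nat.cast_add]
    ring
  set T : Fin k → Fin k → ℂ := fun i l => (b i ^ 2 - 4) * q i * (b i - b l)⁻¹ with hT
  have ho : ∀ i j, i ≠ j → ((resolv (a i) u - dag (resolv (a i) u)) * resolv (a j) u).trace =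
      m - T i j - T j i := by
    intro i j hij
    have h0 := ha i
    have h0' := ha j
    have h1 : a i - a j ≠ 0 := sub_ne_zero.2 fun h => hij (hinj h)
    have h2 : 1 - a i * a j ≠ 0 := sub_ne_zero.2 (hne i j).symm
    have h3 := trace_resolv_mul_resolv (hd i) (hd j)
    have h4 := trace_dag_resolv_mul_resolv hu (hd i) (hd j)
    have h5 : ∀ i, b i ^ 2 - 4 = ((a i)⁻¹ - a i) ^ 2 := fun i => by
      have := ha i
      rw [hb]
      field_simp
      ring
    have h6 : b i - b j = -((a i - a j) * (1 - a i * a j) / (a i * a j)) := by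
      rw [hb, hb]
      field_simp
      ring
    have h7 : b j - b i = (a i - a j) * (1 - a i * a j) / (a i * a j) := by
      rw [← neg_sub, h6, neg_neg]
    rw [sub_mul, trace_sub, ← mul_right_inj' h1, ← mul_right_inj' h2]
    simp only [hT]
    rw [h5, h5, h6, h7, mul_sub, h3, mul_sub, mul_left_comm, h4, htr, htr]
    generalize q i = v
    generalize q j = w
    generalize a i = x at *
    generalize a j = y at *
    field_simp
    ring
  have h1 : ∑ i, ∑ j, ((resolv (a i) u - dag (resolv (a i) u)) * resolv (a j) u).trace =
      ∑ i, ((resolv (a i) u - dag (resolv (a i) u)) * resolv (a i) u).trace +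
        ∑ i, ∑ j ∈ Finset.univ.erase i, (m - T i j - T j i) := by
    rw [← Finset.sum_add_distrib]
    refine Finset.sum_congr rfl fun i _ => ?_
    rw [← Finset.add_sum_erase _ _ (Finset.mem_univ i)]
    congr 1
    exact Finset.sum_congr rfl fun j hj => ho i j (Finset.ne_of_mem_erase hj).symm
  have h2 : ∑ i, ∑ j ∈ Finset.univ.erase i, T j i = ∑ i, ∑ j ∈ Finset.univ.erase i, T i j :=
    Finset.sum_comm' fun i j => by simp [ne_comm]
  have h3 : ∑ i : Fin k, ∑ _j ∈ Finset.univ.erase i, (m : ℂ) = k * (k - 1) * m := by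
    rcases k.eq_zero_or_pos with hk | hk
    · subst hk
      simp
    · simp [Finset.card_erase_of_mem, Nat.cast_sub hk, mul_assoc]
  have h4 := Finset.sum_congr rfl fun i (_ : i ∈ Finset.univ) => hd' i
  rw [Finset.sum_sub_distrib, Finset.sum_neg_distrib, Finset.sum_sub_distrib] at h4
  rw [h1, add_sub_right_comm, h4]
  simp only [Finset.sum_sub_distrib]
  rw [h2, h3]
  simp only [Finset.sum_const, Finset.card_univ, Fintype.card_fin, nsmul_eq_mul]
  ring

end ResolventTraces

section Haar

open scoped Matrix.Norms.L2Operator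

variable {m : ℕ}

instance USp.instBorelSpace : BorelSpace (USp m) := by
  have : BorelSpace (Matrix (Fin m ⊕ Fin m) (Fin m ⊕ Fin m) ℂ) :=
    inferInstanceAs (BorelSpace (Fin m ⊕ Fin m → Fin m ⊕ Fin m → ℂ))
  have : BorelSpace (Matrix.unitaryGroup (Fin m ⊕ Fin m) ℂ) := Subtype.borelSpace _
  exact Subtype.borelSpace _

lemma norm_le_one_of_mem_unitaryGroup {n : Type*} [Fintype n] [DecidableEq n] {u : Matrix n n ℂ}
    (hu : u ∈ unitaryGroup n ℂ) : ‖u‖ ≤ 1 := by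
  rcases subsingleton_or_nontrivial (Matrix n n ℂ) with h | h
  · rw [Subsingleton.elim u 0, norm_zero]
    exact zero_le_one
  · exact (CStarRing.norm_of_mem_unitary hu).le

instance USp.instCompactSpace : CompactSpace (USp m) := by
  have : CompactSpace (Matrix.unitaryGroup (Fin m ⊕ Fin m) ℂ) := by
    refine isCompact_iff_compactSpace.1 (Metric.isCompact_of_isClosed_isBounded isClosed_unitary ?_)
    exact (Metric.isBounded_iff_subset_closedBall 0).2
      ⟨1, fun u hu => by simpa using norm_le_one_of_mem_unitaryGroup hu⟩
  refine isCompact_iff_compactSpace.1 (IsClosed.isCompact ?_)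
  have : IsClosed {u : Matrix.unitaryGroup (Fin m ⊕ Fin m) ℂ |
      (u : Matrix (Fin m ⊕ Fin m) (Fin m ⊕ Fin m) ℂ) * J (Fin m) ℂ *
        (u : Matrix (Fin m ⊕ Fin m) (Fin m ⊕ Fin m) ℂ)ᵀ = J (Fin m) ℂ} :=
    isClosed_eq (by fun_prop) continuous_const
  exact this

lemma det_one_sub_smul_ne_zero {n : Type*} [Fintype n] [DecidableEq n] {u : Matrix n n ℂ}
    (hu : u ∈ unitaryGroup n ℂ) {a : ℂ} (ha : ‖a‖ < 1) : (1 - a • u).det ≠ 0 := by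
  have h : ‖a • u‖ < 1 := by
    rw [norm_smul]
    exact (mul_le_of_le_one_right (norm_nonneg a) (norm_le_one_of_mem_unitaryGroup hu)).trans_lt ha
  exact ((isUnit_iff_isUnit_det _).1 (isUnit_one_sub_of_norm_lt_one h)).ne_zero

lemma continuous_resolv {a : ℂ} (ha : ‖a‖ < 1) :
    Continuous fun u : USp m => resolv a u.1.1 := by
  have h : ∀ u : USp m, resolv a u.1.1 = (1 - a • u.1.1).det⁻¹ • (1 - a • u.1.1).adjugate :=
    fun u => by rw [resolv, inv_def, Ring.inverse_eq_inv']
  have hu : Continuous fun u : USp m => u.1.1 :=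
    continuous_subtype_val.comp continuous_subtype_val
  have h1 : Continuous fun u : USp m => 1 - a • u.1.1 := by fun_prop
  simp only [h]
  exact (h1.matrix_det.inv₀ fun u => det_one_sub_smul_ne_zero u.1.2 ha).smul h1.matrix_adjugate

/-- A continuous function which is a derivative along left translations has vanishing integral. -/
lemma integral_eq_zero_of_hasDerivAt {G : Type*} [Group G] [TopologicalSpace G]
    [IsTopologicalGroup G] [CompactSpace G] [MeasurableSpace G] [BorelSpace G] {μ : Measure G}
    [IsFiniteMeasure μ] [μ.IsMulLeftInvariant] {F F' : G → ℂ} (hF : Continuous F)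
    (hF' : Continuous F') {γ : ℝ → G}
    (h : ∀ t u, HasDerivAt (fun s => F (γ s * u)) (F' (γ t * u)) t) : ∫ u, F' u ∂μ = 0 := by
  obtain ⟨C, hC⟩ := isCompact_univ.exists_bound_of_continuousOn hF'.continuousOn
  have hint : ∀ {f : G → ℂ}, Continuous f → Integrable f μ := fun hf =>
    hf.integrable_of_hasCompactSupport (HasCompactSupport.of_compactSpace _)
  have h1 := (hasDerivAt_integral_of_dominated_loc_of_deriv_le (μ := μ) (x₀ := (0 : ℝ))
    (s := Set.univ) (bound := fun _ => C) (F := fun t u => F (γ t * u))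
    (F' := fun t u => F' (γ t * u)) Filter.univ_mem
    (Filter.Eventually.of_forall fun t => (hint (by fun_prop)).aestronglyMeasurable)
    (hint (by fun_prop)) (hint (by fun_prop)).aestronglyMeasurable
    (Filter.Eventually.of_forall fun u t _ => hC _ (Set.mem_univ _)) (integrable_const C)
    (Filter.Eventually.of_forall fun u t _ => h t u)).2
  simp only [integral_mul_left_eq_self F, integral_mul_left_eq_self F'] at h1
  exact h1.unique (hasDerivAt_const _ _)

lemma dag_exp (X : Matrix (Fin m ⊕ Fin m) (Fin m ⊕ Fin m) ℂ) :
    dag (NormedSpace.exp X) = NormedSpace.exp (dag X) := by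
  have hJ : (J (Fin m) ℂ)⁻¹ = -J (Fin m) ℂ := inv_eq_right_inv (by rw [mul_neg, J_squared, neg_neg])
  have h : ∀ M : Matrix (Fin m ⊕ Fin m) (Fin m ⊕ Fin m) ℂ,
      dag M = J (Fin m) ℂ * Mᵀ * (J (Fin m) ℂ)⁻¹ := fun M => by rw [hJ, dag, mul_neg]
  rw [h, h, exp_conj _ _ ((isUnit_iff_isUnit_det _).2 (isUnit_det_J _ _)), exp_transpose]

lemma exp_mem_symplecticGroup {X : Matrix (Fin m ⊕ Fin m) (Fin m ⊕ Fin m) ℂ} (hX : dag X = -X) :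
    NormedSpace.exp X ∈ symplecticGroup (Fin m) ℂ := by
  have h : NormedSpace.exp X * dag (NormedSpace.exp X) = 1 := by
    rw [dag_exp, hX, exp_neg]
    exact mul_nonsing_inv _ ((isUnit_iff_isUnit_det _).1 (isUnit_exp X))
  rw [SymplecticGroup.mem_iff]
  rw [dag, mul_neg] at h
  have h2 := congrArg (· * J (Fin m) ℂ) h
  simpa [mul_assoc, J_squared] using h2

lemma exp_mem_unitaryGroup {n : Type*} [Fintype n] [DecidableEq n] {X : Matrix n n ℂ}
    (hX : Xᴴ = -X) : NormedSpace.exp X ∈ unitaryGroup n ℂ := by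
  rw [mem_unitaryGroup_iff, star_eq_conjTranspose, ← exp_conjTranspose, hX, exp_neg]
  exact mul_nonsing_inv _ ((isUnit_iff_isUnit_det _).1 (isUnit_exp X))

/-- The one-parameter subgroup of `USp(2m)` generated by an element of its Lie algebra. -/
noncomputable def uspExp {X : Matrix (Fin m ⊕ Fin m) (Fin m ⊕ Fin m) ℂ} (hX : dag X = -X)
    (hX' : Xᴴ = -X) (t : ℝ) : USp m :=
  ⟨⟨NormedSpace.exp ((t : ℂ) • X), exp_mem_unitaryGroup (by simp [conjTranspose_smul, hX'])⟩, exp_mem_symplecticGroup (by rw [dag_smul, hX, smul_neg])⟩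

variable {k : ℕ}

/-- Minus the derivative of `f(u) * ∑ j, tr (R_j Y)` in the direction `X`, divided by `f(u)`, where
`f(u) = ∏ i, det (1 - a i • u)` and `R_j` is the resolvent of `u` at `a j`. -/
noncomputable def secondDeriv (a : Fin k → ℂ) {n : Type*} [Fintype n] [DecidableEq n]
    (u Y X : Matrix n n ℂ) : ℂ :=
  (∑ i, (resolv (a i) u * X).trace) * (∑ j, (resolv (a j) u * Y).trace) -
    ∑ i, (resolv (a i) u * X * (resolv (a i) u - 1) * Y).trace

lemma hasDerivAt_prod_det_mul_sum_trace {n : Type*} [Fintype n] [DecidableEq n] {a : Fin k → ℂ}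
    {U : ℂ → Matrix n n ℂ} {X Y : Matrix n n ℂ} {t : ℂ} (hU : HasDerivAt U (X * U t) t)
    (hX : X.trace = 0) (h : ∀ i, (1 - a i • U t).det ≠ 0) :
    HasDerivAt (fun s => (∏ i, (1 - a i • U s).det) * ∑ j, (resolv (a j) (U s) * Y).trace)
      (-((∏ i, (1 - a i • U t).det) * secondDeriv a (U t) Y X)) t := by
  have h1 := HasDerivAt.fun_finsetProd (u := Finset.univ) fun i _ =>
    hasDerivAt_det_one_sub_smul hU hX (h i)
  have h2 := HasDerivAt.fun_sum (u := Finset.univ) fun j _ =>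
    (hasDerivAt_resolv hU (h j)).matrix_linearMap
      (traceLinearMap n ℂ ℂ ∘ₗ LinearMap.mulRight ℂ Y)
  refine (h1.mul h2).congr_deriv ?_
  simp only [LinearMap.comp_apply, LinearMap.mulRight_apply, traceLinearMap_apply, secondDeriv,
    smul_eq_mul, mul_neg, ← mul_assoc, Finset.prod_erase_mul _ _ (Finset.mem_univ _),
    Finset.sum_neg_distrib, ← Finset.mul_sum]
  ring

lemma secondDeriv_add (a : Fin k → ℂ) {n : Type*} [Fintype n] [DecidableEq n]
    (u Y X X' : Matrix n n ℂ) :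
    secondDeriv a u Y (X + X') = secondDeriv a u Y X + secondDeriv a u Y X' := by
  simp only [secondDeriv, mul_add, add_mul, trace_add, Finset.sum_add_distrib]
  ring

lemma secondDeriv_smul (a : Fin k → ℂ) {n : Type*} [Fintype n] [DecidableEq n] (c : ℂ)
    (u Y X : Matrix n n ℂ) : secondDeriv a u Y (c • X) = c * secondDeriv a u Y X := by
  simp only [secondDeriv, mul_smul_comm, smul_mul_assoc, trace_smul, smul_eq_mul, ← Finset.mul_sum]
  ring

lemma continuous_prod_det (a : Fin k → ℂ) :
    Continuous fun u : USp m => ∏ i, (1 - a i • u.1.1).det := by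
  have hu : Continuous fun u : USp m => u.1.1 :=
    continuous_subtype_val.comp continuous_subtype_val
  exact continuous_finsetProd _ fun i _ =>
    (show Continuous fun u : USp m => 1 - a i • u.1.1 by fun_prop).matrix_det

lemma continuous_secondDeriv {a : Fin k → ℂ} (ha : ∀ i, ‖a i‖ < 1)
    (Y X : Matrix (Fin m ⊕ Fin m) (Fin m ⊕ Fin m) ℂ) :
    Continuous fun u : USp m => secondDeriv a u.1.1 Y X := by
  have h := fun i => continuous_resolv (m := m) (ha i)
  unfold secondDeriv
  have h1 : ∀ Z, Continuous fun u : USp m => ∑ i, (resolv (a i) u.1.1 * Z).trace := fun Z =>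
    continuous_finsetSum _ fun i _ => ((h i).matrix_mul continuous_const).matrix_trace
  refine ((h1 X).mul (h1 Y)).sub (continuous_finsetSum _ fun i _ => ?_)
  exact ((((h i).matrix_mul continuous_const).matrix_mul ((h i).sub continuous_const)).matrix_mul
    continuous_const).matrix_trace

variable {μ : Measure (USp m)} [IsProbabilityMeasure μ] [μ.IsHaarMeasure]

lemma trace_eq_zero_of_dag_eq_neg {X : Matrix (Fin m ⊕ Fin m) (Fin m ⊕ Fin m) ℂ}
    (hX : dag X = -X) : X.trace = 0 := by
  have h := trace_dag X
  rw [hX, trace_neg] at h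
  exact self_eq_neg.1 h.symm

lemma integral_secondDeriv_of_skewAdjoint {a : Fin k → ℂ} (ha : ∀ i, ‖a i‖ < 1)
    {X : Matrix (Fin m ⊕ Fin m) (Fin m ⊕ Fin m) ℂ} (hX : dag X = -X) (hX' : Xᴴ = -X)
    (Y : Matrix (Fin m ⊕ Fin m) (Fin m ⊕ Fin m) ℂ) :
    ∫ u : USp m, (∏ i, (1 - a i • u.1.1).det) * secondDeriv a u.1.1 Y X ∂μ = 0 := by
  have h1 : Continuous fun u : USp m => ∑ j, (resolv (a j) u.1.1 * Y).trace :=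
    continuous_finsetSum _ fun i _ =>
      ((continuous_resolv (ha i)).matrix_mul continuous_const).matrix_trace
  rw [← neg_eq_zero, ← integral_neg]
  refine integral_eq_zero_of_hasDerivAt ((continuous_prod_det a).mul h1)
    ((continuous_prod_det a).mul (continuous_secondDeriv ha Y X)).neg (γ := uspExp hX hX')
    fun t u => ?_
  have hU : ∀ t : ℂ, HasDerivAt (fun s : ℂ => NormedSpace.exp (s • X) * u.1.1)
      (X * (NormedSpace.exp (t • X) * u.1.1)) t := fun t => by
    rw [← mul_assoc]
    exact (hasDerivAt_exp_smul_const' X t).mul_const u.1.1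
  exact (hasDerivAt_prod_det_mul_sum_trace (Y := Y) (hU t) (trace_eq_zero_of_dag_eq_neg hX)
    fun i => det_one_sub_smul_ne_zero (uspExp hX hX' t * u).1.2 (ha i)).comp_ofReal

lemma dag_conjTranspose (X : Matrix (Fin m ⊕ Fin m) (Fin m ⊕ Fin m) ℂ) :
    dag Xᴴ = (dag X)ᴴ := by
  have hJ : (J (Fin m) ℂ)ᴴ = -J (Fin m) ℂ := by
    simp [J, fromBlocks_conjTranspose, fromBlocks_neg]
  simp only [dag, conjTranspose_neg, conjTranspose_mul, hJ, neg_mul, mul_neg, neg_neg, mul_assoc]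
  rfl

lemma integral_secondDeriv {a : Fin k → ℂ} (ha : ∀ i, ‖a i‖ < 1)
    {X : Matrix (Fin m ⊕ Fin m) (Fin m ⊕ Fin m) ℂ} (hX : dag X = -X)
    (Y : Matrix (Fin m ⊕ Fin m) (Fin m ⊕ Fin m) ℂ) :
    ∫ u : USp m, (∏ i, (1 - a i • u.1.1).det) * secondDeriv a u.1.1 Y X ∂μ = 0 := by
  have hd : dag Xᴴ = -Xᴴ := by rw [dag_conjTranspose, hX, conjTranspose_neg]
  have h1 := integral_secondDeriv_of_skewAdjoint (μ := μ) ha (X := X - Xᴴ)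
    (by rw [dag_sub, hX, hd, neg_sub_neg, neg_sub]) (by simp) Y
  have h2 := integral_secondDeriv_of_skewAdjoint (μ := μ) ha (X := Complex.I • (X - -Xᴴ))
    (by
        rw [dag_smul, dag_sub, hX, ← neg_one_smul ℂ Xᴴ, dag_smul, hd, ← smul_neg]
        congr 1
        simp [sub_eq_add_neg, add_comm])
    (by simp [conjTranspose_smul, add_comm]) Y
  have h3 : X = (1 / 2 : ℂ) • (X - Xᴴ) + (-Complex.I / 2) • (Complex.I • (X - -Xᴴ)) := by
    rw [smul_smul, show -Complex.I / 2 * Complex.I = 1 / 2 by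
      linear_combination (-1 / 2 : ℂ) * Complex.I_mul_I, ← smul_add]
    ext i j
    simp
    ring
  have hint : ∀ Z : Matrix (Fin m ⊕ Fin m) (Fin m ⊕ Fin m) ℂ, Integrable
      (fun u : USp m => (∏ i, (1 - a i • u.1.1).det) * secondDeriv a u.1.1 Y Z) μ := fun Z =>
    ((continuous_prod_det a).mul
      (continuous_secondDeriv ha Y Z)).integrable_of_hasCompactSupport
        (HasCompactSupport.of_compactSpace _)
  have h4 : ∀ u : USp m, (∏ i, (1 - a i • u.1.1).det) * secondDeriv a u.1.1 Y X =
      1 / 2 * ((∏ i, (1 - a i • u.1.1).det) * secondDeriv a u.1.1 Y (X - Xᴴ)) +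
        -Complex.I / 2 * ((∏ i, (1 - a i • u.1.1).det) *
          secondDeriv a u.1.1 Y (Complex.I • (X - -Xᴴ))) := fun u => by
    conv_lhs => rw [h3, secondDeriv_add, secondDeriv_smul, secondDeriv_smul _ (-Complex.I / 2)]
    ring
  simp only [h4]
  rw [integral_add ((hint _).const_mul _) ((hint _).const_mul _), integral_const_mul,
    integral_const_mul, h1, h2]
  simp

lemma integral_casimir {a : Fin k → ℂ} (ha : ∀ i, ‖a i‖ < 1) :
    ∫ u : USp m, (∏ i, (1 - a i • u.1.1).det) *
      (∑ i, ∑ j, ((resolv (a i) u.1.1 - dag (resolv (a i) u.1.1)) * resolv (a j) u.1.1).trace -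
        ∑ i, ((resolv (a i) u.1.1).trace * (resolv (a i) u.1.1 - 1).trace +
          (resolv (a i) u.1.1 * (dag (resolv (a i) u.1.1) - 1)).trace)) ∂μ = 0 := by
  have hint : ∀ p q : Fin m ⊕ Fin m, Integrable (fun u : USp m =>
      (∏ i, (1 - a i • u.1.1).det) * secondDeriv a u.1.1 (single q p 1) (spGen p q)) μ :=
    fun p q => ((continuous_prod_det a).mul
      (continuous_secondDeriv ha _ _)).integrable_of_hasCompactSupport
        (HasCompactSupport.of_compactSpace _)
  have h : ∀ u : USp m, ∑ p, ∑ q, secondDeriv a u.1.1 (single q p 1) (spGen p q) = _ := fun u =>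
    sum_casimir fun i => resolv (a i) u.1.1
  simp only [← h, Finset.mul_sum]
  rw [integral_finsetSum _ fun p _ => integrable_finsetSum _ fun q _ => hint p q]
  refine Finset.sum_eq_zero fun p _ => ?_
  rw [integral_finsetSum _ fun q _ => hint p q]
  exact Finset.sum_eq_zero fun q _ => integral_secondDeriv ha (dag_spGen p q) _

end Haar

section AverageWedge

open Polynomial

variable {m k : ℕ}

lemma continuous_coeff_charpoly {n : Type*} [Fintype n] [DecidableEq n] (i : ℕ) :
    Continuous fun M : Matrix n n ℂ => M.charpoly.coeff i := by
  have h : ∀ M : Matrix n n ℂ, M.charpoly.coeff i =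
      MvPolynomial.eval (fun p : n × n => M p.1 p.2) ((charpoly.univ ℂ n).coeff i) := fun M =>
    (charpoly.univ_coeff_eval₂Hom n (RingHom.id ℂ) (fun p : n × n => M p.1 p.2) i).symm
  simp only [h]
  exact (MvPolynomial.continuous_eval _).comp
    (continuous_pi fun p => continuous_id.matrix_elem p.1 p.2)

lemma continuous_linearMap_foldPoly {α : Type*} [TopologicalSpace α] (l : ℂ[X] →ₗ[ℂ] ℂ)
    {p : α → ℂ[X]} (hp : ∀ i, Continuous fun x => (p x).coeff i) :
    Continuous fun x => l (foldPoly m (p x)) := by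
  have h : ∀ x, l (foldPoly m (p x)) = (p x).coeff m * l 1 +
      ∑ n ∈ Finset.range m, (p x).coeff (m - (n + 1)) * l (dickson 1 1 (n + 1)) := fun x => by
    rw [foldPoly, map_add, map_sum, ← mul_one (C _), ← smul_eq_C_mul, map_smul, smul_eq_mul]
    congr 1
    exact Finset.sum_congr rfl fun n _ => by rw [← smul_eq_C_mul, map_smul, smul_eq_mul]
  simp only [h]
  exact ((hp m).mul_const _).add (continuous_finsetSum _ fun n _ => (hp _).mul_const _)

lemma continuous_wedgeCoeff {n : ℕ} (e : Fin k → Fin n) :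
    Continuous fun u : USp m => wedgeCoeff (foldPoly m u.1.1.charpoly) e := by
  have hu : Continuous fun u : USp m => u.1.1 :=
    continuous_subtype_val.comp continuous_subtype_val
  have hc : ∀ i, Continuous fun u : USp m => u.1.1.charpoly.coeff i := fun i =>
    (continuous_coeff_charpoly i).comp hu
  refine Continuous.matrix_det (continuous_matrix fun i j => ?_)
  exact continuous_linearMap_foldPoly (chebCoeff (e i) ∘ₗ LinearMap.mulLeft ℂ (chebS j)) hc

lemma injective_add_inv {ι : Type*} {a : ι → ℂ} (ha : ∀ i, a i ≠ 0) (hinj : Function.Injective a)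
    (hne : ∀ i j, i ≠ j → a i * a j ≠ 1) : Function.Injective fun i => a i + (a i)⁻¹ := by
  intro i j hij
  by_contra h
  have h1 := ha i
  have h2 := ha j
  have h3 : (a i - a j) * (a i * a j - 1) = 0 := by
    have h4 : (a i - a j) * (a i * a j - 1) =
        a i * a j * ((a i + (a i)⁻¹) - (a j + (a j)⁻¹)) := by
      field_simp
      ring
    rw [h4, sub_eq_zero.2 hij, mul_zero]
  rcases mul_eq_zero.1 h3 with h3 | h3
  · exact h (hinj (sub_eq_zero.1 h3))
  · exact hne i j h (sub_eq_zero.1 h3)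

lemma mul_ne_one_of_norm_lt_one {x y : ℂ} (hx : ‖x‖ < 1) (hy : ‖y‖ < 1) : x * y ≠ 1 := by
  intro h
  have h1 := congrArg norm h
  rw [norm_mul, norm_one] at h1
  exact (mul_lt_one_of_nonneg_of_lt_one_left (norm_nonneg x) hx hy.le).ne h1

lemma sum_sq_sub_sum_sq (m k : ℕ) :
    ∑ j : Fin k, ((j : ℂ) + 1) ^ 2 - (k : ℂ) - ∑ j : Fin k, ((m : ℂ) + j + 1) ^ 2 =
      -((k : ℂ) * (m + 1) ^ 2) - k * (k - 1) * m := by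
  induction k with
  | zero => simp
  | succ k ih =>
    rw [Fin.sum_univ_castSucc, Fin.sum_univ_castSucc]
    simp only [Fin.val_castSucc, Fin.val_last]
    push_cast
    linear_combination ih

lemma integrable_wedgeCoeff {μ : Measure (USp m)} [IsFiniteMeasureOnCompacts μ] {n : ℕ}
    (e : Fin k → Fin n) :
    Integrable (fun u : USp m => wedgeCoeff (foldPoly m u.1.1.charpoly) e) μ :=
  (continuous_wedgeCoeff e).integrable_of_hasCompactSupport (HasCompactSupport.of_compactSpace _)

variable {μ : Measure (USp m)} [IsProbabilityMeasure μ] [μ.IsHaarMeasure]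

lemma sum_mul_integral_wedgeCoeff {a : Fin k → ℂ} (ha : ∀ i, a i ≠ 0) (ha1 : ∀ i, ‖a i‖ < 1)
    (hinj : Function.Injective a) :
    ∑ e : Fin k → Fin (m + k),
      ((∑ i, ((e i : ℂ) + 1) ^ 2 - ∑ j : Fin k, ((m : ℂ) + j + 1) ^ 2) *
        ∫ u : USp m, wedgeCoeff (foldPoly m u.1.1.charpoly) e ∂μ) *
        ∏ i, (chebS (e i)).eval (a i + (a i)⁻¹) = 0 := by
  set b : Fin k → ℂ := fun i => a i + (a i)⁻¹ with hb
  set c : ℂ := ∑ j : Fin k, ((m : ℂ) + j + 1) ^ 2 with hc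
  have hne : ∀ i j, a i * a j ≠ 1 := fun i j => mul_ne_one_of_norm_lt_one (ha1 i) (ha1 j)
  have hbi : Function.Injective b := injective_add_inv ha hinj fun i j _ => hne i j
  have hpt : ∀ u : USp m,
      ∑ e : Fin k → Fin (m + k), ((∑ i, ((e i : ℂ) + 1) ^ 2 - c) *
        ∏ i, (chebS (e i)).eval (b i)) * wedgeCoeff (foldPoly m u.1.1.charpoly) e =
      -((Matrix.of fun i j : Fin k => (chebS j).eval (b i)).det * (∏ i, a i ^ m)⁻¹) *
        ((∏ i, (1 - a i • u.1.1).det) *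
      (∑ i, ∑ j, ((resolv (a i) u.1.1 - dag (resolv (a i) u.1.1)) * resolv (a j) u.1.1).trace -
        ∑ i, ((resolv (a i) u.1.1).trace * (resolv (a i) u.1.1 - 1).trace +
          (resolv (a i) u.1.1 * (dag (resolv (a i) u.1.1) - 1)).trace))) := by
    intro u
    have hd : ∀ i, (1 - a i • u.1.1).det ≠ 0 := fun i => det_one_sub_smul_ne_zero u.1.2 (ha1 i)
    have hdet : ∀ i, (1 - a i • u.1.1).det =
        a i ^ m * (foldPoly m u.1.1.charpoly).eval (b i) := fun i => det_one_sub_smul_eq u.2 (ha i)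
    have hh : ∀ i, (foldPoly m u.1.1.charpoly).eval (b i) ≠ 0 := fun i h0 =>
      hd i (by rw [hdet, h0, mul_zero])
    have hdeg := (foldPoly_charpoly_monic_natDegree u.2).2
    have h1 := sum_sq_mul_wedgeCoeff_eq hdeg hbi hh
    have h2 := sum_wedgeCoeff hdeg b
    have hprod : (∏ i, a i ^ m) ≠ 0 := Finset.prod_ne_zero_iff.2 fun i _ => pow_ne_zero _ (ha i)
    rw [sum_trace_resolv_eq u.2 ha hinj hne hd (fun _ => rfl) rfl]
    simp only [hdet, Finset.prod_mul_distrib]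
    have h3 : ∑ e : Fin k → Fin (m + k), ((∑ i, ((e i : ℂ) + 1) ^ 2 - c) *
        ∏ i, (chebS (e i)).eval (b i)) * wedgeCoeff (foldPoly m u.1.1.charpoly) e =
        ∑ e : Fin k → Fin (m + k), (∑ i, ((e i : ℂ) + 1) ^ 2) *
          ((∏ i, (chebS (e i)).eval (b i)) * wedgeCoeff (foldPoly m u.1.1.charpoly) e) -
        c * ∑ e : Fin k → Fin (m + k),
          (∏ i, (chebS (e i)).eval (b i)) * wedgeCoeff (foldPoly m u.1.1.charpoly) e := by
      rw [Finset.mul_sum, ← Finset.sum_sub_distrib]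
      exact Finset.sum_congr rfl fun e _ => by ring
    rw [h3, h1, h2]
    have h4 := sum_sq_sub_sum_sq m k
    rw [← hc] at h4
    rw [neg_mul, mul_neg, mul_neg, neg_neg, mul_assoc _ (∏ i, a i ^ m)⁻¹, mul_assoc (∏ i, a i ^ m),
      inv_mul_cancel_left₀ hprod]
    linear_combination (Matrix.of fun i j : Fin k => (chebS j).eval (b i)).det *
      (∏ i, (foldPoly m u.1.1.charpoly).eval (b i)) * h4
  have h := integral_congr_ae (μ := μ) (Filter.Eventually.of_forall hpt)
  rw [integral_const_mul, integral_casimir ha1, mul_zero,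
    integral_finsetSum _ fun e _ => (integrable_wedgeCoeff e).const_mul _] at h
  simp only [integral_const_mul] at h
  rw [← h]
  exact Finset.sum_congr rfl fun e _ => by ring

lemma integral_wedgeCoeff_eigen (e : Fin k → Fin (m + k)) :
    (∑ i, ((e i : ℂ) + 1) ^ 2 - ∑ j : Fin k, ((m : ℂ) + j + 1) ^ 2) *
      ∫ u : USp m, wedgeCoeff (foldPoly m u.1.1.charpoly) e ∂μ = 0 := by
  set x : Fin k × Fin (m + k) → ℂ := fun p => (((finProdFinEquiv p : ℕ) + 2 : ℕ) : ℂ)⁻¹ with hx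
  have hx0 : ∀ p, x p ≠ 0 := fun p => inv_ne_zero (Nat.cast_ne_zero.2 (by omega))
  have hx1 : ∀ p, ‖x p‖ < 1 := fun p => by
    rw [hx, norm_inv, Complex.norm_natCast]
    exact inv_lt_one_of_one_lt₀ (by exact_mod_cast (by omega))
  have hinj : Function.Injective x := fun p q h => by
    have h1 := Nat.cast_injective (inv_injective h)
    exact finProdFinEquiv.injective (Fin.ext (by omega))
  have hbi := injective_add_inv hx0 hinj fun p q _ => mul_ne_one_of_norm_lt_one (hx1 p) (hx1 q)
  refine congrFun (eq_zero_of_sum_mul_prod_eq_zero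
    (fun i => Matrix.of fun r e : Fin (m + k) => (chebS e).eval (x (i, r) + (x (i, r))⁻¹))
    (fun i => (det_eval_chebS_ne_zero fun r s h => ?_).isUnit)
    (fun e => (∑ i, ((e i : ℂ) + 1) ^ 2 - ∑ j : Fin k, ((m : ℂ) + j + 1) ^ 2) *
      ∫ u : USp m, wedgeCoeff (foldPoly m u.1.1.charpoly) e ∂μ) fun r => ?_) e
  · exact congrArg Prod.snd (hbi h)
  · exact sum_mul_integral_wedgeCoeff (a := fun i => x (i, r i)) (fun i => hx0 _) (fun i => hx1 _)
      fun i j h => congrArg Prod.fst (hinj h)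

/-- The Haar average of a product of values of characteristic polynomials, in terms of the
variables `a + a⁻¹`. -/
lemma det_mul_integral_prod_eval (b : Fin k → ℂ) :
    (Matrix.of fun i j : Fin k => (chebS j).eval (b i)).det *
        ∫ u : USp m, ∏ i, (foldPoly m u.1.1.charpoly).eval (b i) ∂μ =
      (Matrix.of fun i j : Fin k => (chebS (m + j)).eval (b i)).det := by
  rw [← eq_det_of_eigen (Hc := fun e =>
    ∫ u : USp m, wedgeCoeff (foldPoly m u.1.1.charpoly) e ∂μ) (fun e he => ?_) (fun e he => ?_)
    integral_wedgeCoeff_eigen b, ← integral_const_mul]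
  · simp only [fun u : USp m => (sum_wedgeCoeff (foldPoly_charpoly_monic_natDegree u.2).2 b).symm]
    rw [integral_finsetSum _ fun e _ => (integrable_wedgeCoeff e).const_mul _]
    simp only [integral_const_mul]
  · simp [wedgeCoeff_of_not_injective _ he]
  · have h : ∀ u : USp m, wedgeCoeff (foldPoly m u.1.1.charpoly) e = _ := fun u =>
      wedgeCoeff_of_le (foldPoly_charpoly_monic_natDegree u.2).1
        (foldPoly_charpoly_monic_natDegree u.2).2 he
    simp only [h]
    simp

end AverageWedge

section ToeplitzHankel

open Polynomial

variable {m k : ℕ}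

/-- The symbol `phiGG a` as a polynomial in `2 cos θ`. -/
noncomputable def symbolPoly (a : Fin k → ℂ) : ℂ[X] := ∏ i, (C (-a i) * X + C (1 + a i ^ 2))

lemma phiGG_eq_eval (a : Fin k → ℂ) (θ : ℝ) : phiGG a θ =
    (symbolPoly a).eval (Complex.exp (Complex.I * θ) + Complex.exp (-Complex.I * θ)) := by
  have h : Complex.exp (Complex.I * θ) * Complex.exp (-Complex.I * θ) = 1 := by
    rw [← Complex.exp_add]
    simp
  rw [phiGG, symbolPoly, eval_prod, ← Finset.prod_mul_distrib]
  refine Finset.prod_congr rfl fun i _ => ?_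
  simp only [eval_add, eval_mul, eval_C, eval_X]
  linear_combination a i ^ 2 * h

/-- The Toeplitz-minus-Hankel matrix of `phiGG a`. -/
noncomputable def toeplitzMinusHankel (m : ℕ) (a : Fin k → ℂ) : Matrix (Fin m) (Fin m) ℂ :=
  Matrix.of fun j k' : Fin m =>
    fCoeff (phiGG a) (((j : ℕ) : ℤ) - ((k' : ℕ) : ℤ)) -
      fCoeff (phiGG a) (((j : ℕ) : ℤ) + ((k' : ℕ) : ℤ) + 2)

lemma toeplitzMinusHankel_eq (a : Fin k → ℂ) : toeplitzMinusHankel m a =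
    Matrix.of fun j j' : Fin m => chebCoeff j (symbolPoly a * chebS j') := by
  ext j j'
  rw [of_apply, chebCoeff_mul_chebS, cosCoeff, cosCoeff]
  simp only [← phiGG_eq_eval]
  rfl

lemma det_toeplitzMinusHankel_mul {a : Fin k → ℂ} (ha : ∀ i, a i ≠ 0) :
    (toeplitzMinusHankel m a).det *
        (Matrix.of fun i j : Fin k => (chebS j).eval (a i + (a i)⁻¹)).det =
      (Equiv.Perm.sign (blockSwap m k) : ℂ) * (∏ i, -a i) ^ m *
        (Matrix.of fun i j : Fin k => (chebS (m + j)).eval (a i + (a i)⁻¹)).det := by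
  have hlead : ∀ i, (C (-a i) * X + C (1 + a i ^ 2)).leadingCoeff = -a i := fun i =>
    leadingCoeff_linear (neg_ne_zero.2 (ha i))
  have hne : ∀ i, C (-a i) * X + C (1 + a i ^ 2) ≠ 0 := fun i h => by
    have := hlead i
    rw [h, leadingCoeff_zero] at this
    exact neg_ne_zero.2 (ha i) this.symm
  have hdeg : (symbolPoly a).natDegree = k := by
    rw [symbolPoly, natDegree_prod _ _ fun i _ => hne i,
      Finset.sum_congr rfl fun i _ => natDegree_linear (neg_ne_zero.2 (ha i))]
    simp
  have hroot : ∀ i, (symbolPoly a).eval (a i + (a i)⁻¹) = 0 := fun i => by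
    rw [symbolPoly, eval_prod]
    refine Finset.prod_eq_zero (Finset.mem_univ i) ?_
    have := ha i
    simp only [eval_add, eval_mul, eval_C, eval_X]
    field_simp
    ring
  rw [toeplitzMinusHankel_eq, det_chebCoeff_mul_det_eval m k _ hdeg
    (Finset.prod_ne_zero_iff.2 fun i _ => hne i) _ hroot, symbolPoly, leadingCoeff_prod,
    Finset.prod_congr rfl fun i _ => hlead i]

lemma continuous_det_toeplitzMinusHankel :
    Continuous fun a : Fin k → ℂ => (toeplitzMinusHankel m a).det := by
  have h : ∀ n : ℤ, Continuous fun a : Fin k → ℂ => fCoeff (phiGG a) n := fun n => by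
    refine continuous_const.mul
      (intervalIntegral.continuous_parametric_intervalIntegral_of_continuous' ?_ _ _)
    unfold phiGG
    fun_prop
  exact Continuous.matrix_det (continuous_matrix fun i j => (h _).sub (h _))

lemma continuous_integral_prod_det {μ : Measure (USp m)} [IsFiniteMeasureOnCompacts μ] :
    Continuous fun a : Fin k → ℂ => ∫ u : USp m, ∏ i, (1 - a i • u.1.1).det ∂μ := by
  have hu : Continuous fun p : (Fin k → ℂ) × USp m => p.2.1.1 :=
    continuous_subtype_val.comp (continuous_subtype_val.comp continuous_snd)
  have h : Continuous (Function.uncurry fun (a : Fin k → ℂ) (u : USp m) =>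
      ∏ i, (1 - a i • u.1.1).det) :=
    continuous_finsetProd _ fun i _ => Continuous.matrix_det
      (continuous_const.sub ((continuous_apply i |>.comp continuous_fst).smul hu))
  simpa using continuous_parametric_integral_of_continuous (μ := μ) h isCompact_univ

lemma eventually_eval_ne_zero {p : ℂ[X]} (hp : p ≠ 0) (x : ℂ) :
    ∀ᶠ t in nhdsWithin x {x}ᶜ, p.eval t ≠ 0 := by
  refine nhdsNE_le_cofinite x (Filter.eventually_cofinite.2 ?_)
  refine p.roots.toFinset.finite_toSet.subset fun t ht => ?_
  simpa [hp] using ht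

variable {μ : Measure (USp m)} [IsProbabilityMeasure μ] [μ.IsHaarMeasure]

lemma det_toeplitzMinusHankel_of_generic {a : Fin k → ℂ} (ha : ∀ i, a i ≠ 0)
    (hinj : Function.Injective a) (hne : ∀ i j, i ≠ j → a i * a j ≠ 1) :
    (toeplitzMinusHankel m a).det = (Equiv.Perm.sign (blockSwap m k) : ℂ) * ((-1) ^ k) ^ m *
      ∫ u : USp m, ∏ i, (1 - a i • u.1.1).det ∂μ := by
  have hV := det_eval_chebS_ne_zero (injective_add_inv ha hinj hne)
  have h1 := det_toeplitzMinusHankel_mul (m := m) ha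
  rw [← det_mul_integral_prod_eval (μ := μ)] at h1
  have h2 : ∫ u : USp m, ∏ i, (1 - a i • u.1.1).det ∂μ = (∏ i, a i) ^ m *
      ∫ u : USp m, ∏ i, (foldPoly m u.1.1.charpoly).eval (a i + (a i)⁻¹) ∂μ := by
    rw [← integral_const_mul]
    refine integral_congr_ae (Filter.Eventually.of_forall fun u => ?_)
    simp only [fun i => det_one_sub_smul_eq u.2 (ha i), Finset.prod_mul_distrib, Finset.prod_pow]
  have h3 : ∏ i, -a i = (-1) ^ k * ∏ i, a i := by
    rw [Finset.prod_neg, Finset.card_univ, Fintype.card_fin]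
  apply mul_right_cancel₀ hV
  rw [h1, h2, h3, mul_pow]
  ring

lemma det_toeplitzMinusHankel_eq_mul (a : Fin k → ℂ) :
    (toeplitzMinusHankel m a).det = (Equiv.Perm.sign (blockSwap m k) : ℂ) * ((-1) ^ k) ^ m *
      ∫ u : USp m, ∏ i, (1 - a i • u.1.1).det ∂μ := by
  set p : Fin k → ℂ[X] := fun i => C ((i : ℂ) + 1) * X + C (a i) with hp
  have hpath : Continuous fun (t : ℂ) i => (p i).eval t := by fun_prop
  have h0 : (fun i => (p i).eval 0) = a := by
    funext i
    simp [hp]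
  have hi : ∀ i : Fin k, (i : ℂ) + 1 ≠ 0 := fun i => Nat.cast_add_one_ne_zero i
  have hdeg : ∀ i, (p i).natDegree = 1 := fun i => natDegree_linear (hi i)
  have hp0 : ∀ i, p i ≠ 0 := fun i h => by simpa [h] using hdeg i
  have hsub : ∀ i j, i ≠ j → p i - p j ≠ 0 := fun i j hij h => by
    have := congrArg (fun q => q.coeff 1) h
    simp only [hp, coeff_sub, coeff_add, coeff_C_mul, coeff_X_one, coeff_C_succ, coeff_zero] at this
    exact hij (Fin.ext (by exact_mod_cast (by linear_combination this : (i : ℂ) = j)))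
  have hmul : ∀ i j, p i * p j - 1 ≠ 0 := fun i j h => by
    have := congrArg natDegree (sub_eq_zero.1 h)
    rw [natDegree_mul (hp0 i) (hp0 j), hdeg, hdeg, natDegree_one] at this
    omega
  have hev : ∀ᶠ t in nhdsWithin (0 : ℂ) {0}ᶜ,
      (toeplitzMinusHankel m fun i => (p i).eval t).det =
        (Equiv.Perm.sign (blockSwap m k) : ℂ) * ((-1) ^ k) ^ m *
          ∫ u : USp m, ∏ i, (1 - (p i).eval t • u.1.1).det ∂μ := by
    filter_upwards [Filter.eventually_all.2 fun i => eventually_eval_ne_zero (hp0 i) 0,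
      Filter.eventually_all.2 fun i => Filter.eventually_all.2 fun j =>
        Filter.eventually_all.2 fun hij => eventually_eval_ne_zero (hsub i j hij) 0,
      Filter.eventually_all.2 fun i => Filter.eventually_all.2 fun j =>
        eventually_eval_ne_zero (hmul i j) 0] with t h1 h2 h3
    refine det_toeplitzMinusHankel_of_generic h1 (fun i j hij => ?_) fun i j _ hij => ?_
    · by_contra hne
      exact h2 i j hne (by rw [eval_sub, sub_eq_zero.2 hij])
    · exact h3 i j (by rw [eval_sub, eval_mul, hij, eval_one, sub_self])
  have hL := (continuous_det_toeplitzMinusHankel (m := m)).comp hpath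
  have hR := ((continuous_integral_prod_det (μ := μ)).comp hpath).const_mul
    ((Equiv.Perm.sign (blockSwap m k) : ℂ) * ((-1) ^ k) ^ m)
  have := tendsto_nhds_unique_of_eventuallyEq
    ((hL.tendsto 0).mono_left nhdsWithin_le_nhds) ((hR.tendsto 0).mono_left nhdsWithin_le_nhds) hev
  simpa only [Function.comp_apply, congrFun h0, h0] using this

lemma toeplitzMinusHankel_zero : toeplitzMinusHankel m (0 : Fin k → ℂ) = 1 := by
  rw [toeplitzMinusHankel_eq]
  ext i j
  simp [symbolPoly, chebCoeff_chebS, Matrix.one_apply, Fin.ext_iff]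

end ToeplitzHankel

/-- The Haar average over `USp(2m)` of `∏_i det(1 - a_i u)` equals
`det (φ_{j-k} - φ_{j+k+2})_{0 ≤ j,k < m}`. -/
theorem usp_average_eq_toeplitz_minus_hankel (m : ℕ) (hm : 1 ≤ m)
    (k : ℕ) (a : Fin k → ℂ)
    (μ : Measure (USp m))
    [IsProbabilityMeasure μ] [μ.IsHaarMeasure] :
    (∫ u : USp m,
        ∏ i : Fin k,
          ((1 : Matrix (Fin m ⊕ Fin m) (Fin m ⊕ Fin m) ℂ) -
            a i • ((u : Matrix.unitaryGroup (Fin m ⊕ Fin m) ℂ) :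
              Matrix (Fin m ⊕ Fin m) (Fin m ⊕ Fin m) ℂ)).det ∂μ)
      = (Matrix.of fun j k' : Fin m =>
          fCoeff (phiGG a) (((j : ℕ) : ℤ) - ((k' : ℕ) : ℤ)) -
            fCoeff (phiGG a) (((j : ℕ) : ℤ) + ((k' : ℕ) : ℤ) + 2)).det := by
  have h0 := det_toeplitzMinusHankel_eq_mul (μ := μ) (0 : Fin k → ℂ)
  have h := det_toeplitzMinusHankel_eq_mul (μ := μ) a
  simp only [toeplitzMinusHankel_zero, det_one, Pi.zero_apply, zero_smul, sub_zero,
    Finset.prod_const_one, integral_const, probReal_univ, one_smul, mul_one] at h0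
  rw [← h0, one_mul] at h
  exact h.symm
end

section
/- Let N ≥ 1 and let a, b be complex numbers with ab ≠ 1. Then ∫_{U(N)} det(I − aU) · det(I − bU*) dU = (1 − (ab)^{N+1})/(1 − ab). Equivalently, writing a = e^{−α}, b = e^{−β} and z(x) = 1/(1 − e^{−x}), this average equals z(α+β) + e^{−N(α+β)} · z(−α−β). -/
open MeasureTheory Matrix

namespace Matrix

section Algebra

variable {m n R : Type*} [Fintype m] [DecidableEq m] [Fintype n] [CommRing R]

/-- `det (1 + M)` is the sum of all principal minors of `M`. -/
theorem det_one_add_eq_sum_minors [DecidableEq n] (M : Matrix n n R) :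
    (1 + M).det = ∑ s : Finset n, (M.submatrix ((↑) : s → n) (↑)).det := by
  rw [add_comm]
  have h := (detRowAlternating (R := R) (n := n)).map_add_univ M.row (1 : Matrix n n R).row
  refine h.trans (Finset.sum_congr rfl fun s _ => ?_)
  exact det_piecewise_one_eq_submatrix_det M s

theorem det_one_sub_smul_eq_sum_minors [DecidableEq n] (a : R) (M : Matrix n n R) :
    (1 - a • M).det = ∑ s : Finset n, (-a) ^ s.card * (M.submatrix ((↑) : s → n) (↑)).det := by
  rw [sub_eq_add_neg, ← neg_smul, det_one_add_eq_sum_minors]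
  refine Finset.sum_congr rfl fun s _ => ?_
  rw [submatrix_smul, Pi.smul_apply, Pi.smul_apply, det_smul, Fintype.card_coe]

/-- Expansion of the determinant of a product of rectangular matrices by rows. -/
theorem det_mul_eq_sum_prod_mul_det (A : Matrix m n R) (B : Matrix n m R) :
    (A * B).det = ∑ f : m → n, (∏ i, A i (f i)) * (B.submatrix f id).det := by
  have h := (detRowAlternating (R := R) (n := m)).toMultilinearMap.map_sum
    (fun i j => A i j • B.row j)
  have hAB : (fun i => ∑ j, A i j • B.row j) = A * B := by
    ext i k
    simp [mul_apply]
  rw [hAB] at h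
  refine h.trans (Finset.sum_congr rfl fun f _ => ?_)
  exact (detRowAlternating (R := R) (n := m)).toMultilinearMap.map_smul_univ
    (fun i => A i (f i)) (fun i => B.row (f i))

/-- The Cauchy–Binet formula, summed over all maps of row indices instead of over subsets. -/
theorem sum_det_submatrix_mul_det_submatrix (A : Matrix m n R) (B : Matrix n m R) :
    ∑ f : m → n, (A.submatrix id f).det * (B.submatrix f id).det =
      (Fintype.card m).factorial * (A * B).det := by
  have key (σ : Equiv.Perm m) :
      ∑ f : m → n, ((σ.sign : ℤ) : R) * (∏ i, A (σ i) (f i)) * (B.submatrix f id).det =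
        (A * B).det := by
    rw [det_mul_eq_sum_prod_mul_det]
    refine Fintype.sum_equiv (Equiv.arrowCongr σ (Equiv.refl n)) _ _ fun f => ?_
    have hd : (B.submatrix f id).det =
        ((σ.sign : ℤ) : R) * (B.submatrix (f ∘ σ.symm) id).det := by
      rw [← det_permute σ]
      congr 1
      ext i j
      simp
    have hp : ∏ i, A i (f (σ.symm i)) = ∏ i, A (σ i) (f i) :=
      Fintype.prod_equiv σ.symm _ _ (by simp)
    have hs : ((σ.sign : ℤ) : R) * ((σ.sign : ℤ) : R) = 1 := by
      rw [← Int.cast_mul, Int.units_coe_mul_self, Int.cast_one]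
    change _ = (∏ i, A i (f (σ.symm i))) * (B.submatrix (f ∘ σ.symm) id).det
    rw [hd, hp]
    linear_combination (∏ i, A (σ i) (f i)) * (B.submatrix (f ∘ σ.symm) id).det * hs
  calc _ = ∑ f : m → n, ∑ σ : Equiv.Perm m,
        ((σ.sign : ℤ) : R) * (∏ i, A (σ i) (f i)) * (B.submatrix f id).det := by
        refine Finset.sum_congr rfl fun f _ => ?_
        rw [det_apply', Finset.sum_mul]
        rfl
    _ = _ := by
        rw [Finset.sum_comm, Finset.sum_congr rfl fun σ _ => key σ]
        simp [Fintype.card_perm]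

theorem det_submatrix_diagonal_mul [DecidableEq n] (d : n → R) (M : Matrix n n R) (f g : m → n) :
    ((diagonal d * M).submatrix f g).det = (∏ i, d (f i)) * (M.submatrix f g).det := by
  rw [← det_mul_column]
  congr 1
  ext i j
  simp [diagonal_mul]

end Algebra

section Unitary

variable {n : Type*} [Fintype n] [DecidableEq n]

instance borelSpace_matrix : BorelSpace (Matrix n n ℂ) :=
  inferInstanceAs (BorelSpace (n → n → ℂ))

instance secondCountableTopology_matrix : SecondCountableTopology (Matrix n n ℂ) :=
  inferInstanceAs (SecondCountableTopology (n → n → ℂ))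

instance compactSpace_unitaryGroup : CompactSpace (unitaryGroup n ℂ) := by
  refine (isCompact_iff_compactSpace (s := (unitaryGroup n ℂ : Set (Matrix n n ℂ)))).1 ?_
  refine IsCompact.of_isClosed_subset
    (isCompact_univ_pi fun _ : n => isCompact_univ_pi fun _ : n =>
      isCompact_closedBall (0 : ℂ) 1) ?_ ?_
  · have h : (unitaryGroup n ℂ : Set (Matrix n n ℂ)) = {U | U * star U = 1} := by
      ext U
      exact mem_unitaryGroup_iff
    rw [h]
    exact isClosed_eq (by fun_prop) continuous_const
  · intro U hU i _ j _
    simpa using entry_norm_bound_of_unitary hU i j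

theorem diagonal_mem_unitaryGroup {d : n → ℂ} (hd : ∀ i, d i * star (d i) = 1) :
    diagonal d ∈ unitaryGroup n ℂ := by
  rw [mem_unitaryGroup_iff, star_eq_conjTranspose, diagonal_conjTranspose, diagonal_mul_diagonal,
    ← diagonal_one]
  exact congrArg diagonal (funext hd)

theorem permMatrix_mem_unitaryGroup (σ : Equiv.Perm n) :
    σ.permMatrix ℂ ∈ unitaryGroup n ℂ := by
  rw [mem_unitaryGroup_iff, star_eq_conjTranspose, conjTranspose_permMatrix, ← permMatrix_mul]
  simp

@[fun_prop]
theorem continuous_det_submatrix_unitaryGroup {m : Type*} [Fintype m] [DecidableEq m]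
    (f g : m → n) : Continuous fun U : unitaryGroup n ℂ => ((U : Matrix n n ℂ).submatrix f g).det :=
  (continuous_subtype_val.matrix_submatrix f g).matrix_det

variable (μ : Measure (unitaryGroup n ℂ)) [μ.IsHaarMeasure]

theorem _root_.Continuous.integrable_unitaryGroup {f : unitaryGroup n ℂ → ℂ} (hf : Continuous f) :
    Integrable f μ :=
  hf.integrable_of_hasCompactSupport (HasCompactSupport.of_compactSpace f)

/-- Distinct principal minors are orthogonal: flip the sign of a row met by only one of them. -/
theorem integral_minor_mul_star_minor_of_ne {s t : Finset n} (hst : s ≠ t) :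
    ∫ U : unitaryGroup n ℂ, ((U : Matrix n n ℂ).submatrix ((↑) : s → n) (↑)).det *
      star ((U : Matrix n n ℂ).submatrix ((↑) : t → n) (↑)).det ∂μ = 0 := by
  obtain ⟨i, hi⟩ : ∃ i, ¬(i ∈ s ↔ i ∈ t) := by
    by_contra! h
    exact hst (Finset.ext h)
  let d : n → ℂ := Function.update 1 i (-1)
  have hd : diagonal d ∈ unitaryGroup n ℂ := diagonal_mem_unitaryGroup fun j => by
    rcases eq_or_ne j i with rfl | h <;> simp [d, *]
  have hprod (r : Finset n) : ∏ j : r, d j = if i ∈ r then -1 else 1 := by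
    rw [Finset.prod_coe_sort r d]
    simp only [d]
    split_ifs with h
    · simp [Finset.prod_update_of_mem h]
    · simp [Finset.prod_update_of_notMem h]
  have h := integral_mul_left_eq_self (μ := μ)
    (fun U : unitaryGroup n ℂ => ((U : Matrix n n ℂ).submatrix ((↑) : s → n) (↑)).det *
      star ((U : Matrix n n ℂ).submatrix ((↑) : t → n) (↑)).det) ⟨_, hd⟩
  simp only [UnitaryGroup.mul_val, det_submatrix_diagonal_mul, hprod] at h
  rw [← self_eq_neg, ← integral_neg]
  refine h.symm.trans (integral_congr_ae (.of_forall fun U => ?_))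
  by_cases hs : i ∈ s <;> by_cases ht : i ∈ t <;> simp_all

/-- Minors with a fixed set of columns all have the same second moment: permute the rows. -/
theorem integral_minor_mul_star_minor_of_injective (s : Finset n) {f : s → n}
    (hf : Function.Injective f) :
    ∫ U : unitaryGroup n ℂ, ((U : Matrix n n ℂ).submatrix f ((↑) : s → n)).det *
        star ((U : Matrix n n ℂ).submatrix f ((↑) : s → n)).det ∂μ =
      ∫ U : unitaryGroup n ℂ, ((U : Matrix n n ℂ).submatrix ((↑) : s → n) (↑)).det *
        star ((U : Matrix n n ℂ).submatrix ((↑) : s → n) (↑)).det ∂μ := by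
  obtain ⟨σ, hσ⟩ : ∃ σ : Equiv.Perm n, ∀ i : s, σ i = f i := by
    refine ⟨(Equiv.ofInjective f hf).extendSubtype, fun i => ?_⟩
    rw [Equiv.extendSubtype_apply_of_mem _ _ i.2]
    rfl
  have h := integral_mul_left_eq_self (μ := μ)
    (fun U : unitaryGroup n ℂ => ((U : Matrix n n ℂ).submatrix ((↑) : s → n) (↑)).det *
      star ((U : Matrix n n ℂ).submatrix ((↑) : s → n) (↑)).det) ⟨_, permMatrix_mem_unitaryGroup σ⟩
  rw [← h]
  have hsub : (σ : n → n) ∘ ((↑) : s → n) = f := funext hσ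
  simp only [UnitaryGroup.mul_val, PEquiv.toMatrix_toPEquiv_mul, submatrix_submatrix, hsub,
    Function.id_comp]

/-- The second moment of a principal minor of a Haar unitary matrix. -/
theorem integral_minor_mul_star_minor_self [IsProbabilityMeasure μ] (s : Finset n) :
    ∫ U : unitaryGroup n ℂ, ((U : Matrix n n ℂ).submatrix ((↑) : s → n) (↑)).det *
      star ((U : Matrix n n ℂ).submatrix ((↑) : s → n) (↑)).det ∂μ =
      ((Fintype.card n).choose s.card : ℂ)⁻¹ := by
  classical
  set c := ∫ U : unitaryGroup n ℂ, ((U : Matrix n n ℂ).submatrix ((↑) : s → n) (↑)).det *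
      star ((U : Matrix n n ℂ).submatrix ((↑) : s → n) (↑)).det ∂μ
  have hsum (U : unitaryGroup n ℂ) :
      ∑ f : s → n, ((U : Matrix n n ℂ).submatrix f ((↑) : s → n)).det *
        star ((U : Matrix n n ℂ).submatrix f ((↑) : s → n)).det = (s.card.factorial : ℂ) := by
    have h := sum_det_submatrix_mul_det_submatrix
      ((star (U : Matrix n n ℂ)).submatrix ((↑) : s → n) id)
      ((U : Matrix n n ℂ).submatrix id ((↑) : s → n))
    rw [← submatrix_mul _ _ _ _ _ Function.bijective_id, UnitaryGroup.star_mul_self,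
      submatrix_one _ Subtype.val_injective, det_one, mul_one, Fintype.card_coe] at h
    rw [← h]
    refine Finset.sum_congr rfl fun f _ => ?_
    rw [mul_comm, ← det_conjTranspose]
    rfl
  have h_integrable (f : s → n) : Integrable (fun U : unitaryGroup n ℂ =>
      ((U : Matrix n n ℂ).submatrix f ((↑) : s → n)).det *
        star ((U : Matrix n n ℂ).submatrix f ((↑) : s → n)).det) μ :=
    Continuous.integrable_unitaryGroup μ (by fun_prop)
  have hterm (f : s → n) : ∫ U : unitaryGroup n ℂ,
      ((U : Matrix n n ℂ).submatrix f ((↑) : s → n)).det *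
        star ((U : Matrix n n ℂ).submatrix f ((↑) : s → n)).det ∂μ =
      if Function.Injective f then c else 0 := by
    split_ifs with hf
    · exact integral_minor_mul_star_minor_of_injective μ s hf
    · simp only [Function.Injective, not_forall] at hf
      obtain ⟨i, j, hij, hne⟩ := hf
      have hz (U : unitaryGroup n ℂ) : ((U : Matrix n n ℂ).submatrix f ((↑) : s → n)).det = 0 :=
        det_zero_of_row_eq hne (by ext k; simp [hij])
      simp [hz]
  have hcard : (Finset.univ.filter fun f : s → n => Function.Injective f).card =
      (Fintype.card n).descFactorial s.card := by
    rw [← Fintype.card_subtype, Fintype.card_congr (Equiv.subtypeInjectiveEquivEmbedding s n),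
      Fintype.card_embedding_eq, Fintype.card_coe]
  have h : ((Fintype.card n).descFactorial s.card : ℂ) * c = s.card.factorial := by
    calc _ = ∑ f : s → n, if Function.Injective f then c else 0 := by
          rw [← Finset.sum_filter, Finset.sum_const, hcard, nsmul_eq_mul]
      _ = ∫ U : unitaryGroup n ℂ, ∑ f : s → n,
            ((U : Matrix n n ℂ).submatrix f ((↑) : s → n)).det *
              star ((U : Matrix n n ℂ).submatrix f ((↑) : s → n)).det ∂μ := by
          rw [integral_finsetSum _ fun f _ => h_integrable f]
          exact Finset.sum_congr rfl fun f _ => (hterm f).symm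
      _ = _ := by simp only [hsum, integral_const, probReal_univ, one_smul]
  rw [Nat.descFactorial_eq_factorial_mul_choose, Nat.cast_mul, mul_assoc] at h
  refine eq_inv_of_mul_eq_one_right (mul_left_cancel₀ (Nat.cast_ne_zero.2 s.card.factorial_ne_zero)
    (h.trans (mul_one _).symm))

theorem integral_det_one_sub_mul_det_one_sub_star [IsProbabilityMeasure μ] (a b : ℂ) :
    ∫ U : unitaryGroup n ℂ, (1 - a • (U : Matrix n n ℂ)).det *
        (1 - b • star (U : Matrix n n ℂ)).det ∂μ =
      ∑ k ∈ Finset.range (Fintype.card n + 1), (a * b) ^ k := by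
  have hexp (U : unitaryGroup n ℂ) : (1 - a • (U : Matrix n n ℂ)).det *
      (1 - b • star (U : Matrix n n ℂ)).det = ∑ s : Finset n, ∑ t : Finset n,
        ((-a) ^ s.card * (-b) ^ t.card) *
          (((U : Matrix n n ℂ).submatrix ((↑) : s → n) (↑)).det *
            star ((U : Matrix n n ℂ).submatrix ((↑) : t → n) (↑)).det) := by
    rw [det_one_sub_smul_eq_sum_minors, det_one_sub_smul_eq_sum_minors, Finset.sum_mul_sum]
    refine Finset.sum_congr rfl fun s _ => Finset.sum_congr rfl fun t _ => ?_
    rw [← det_conjTranspose, conjTranspose_submatrix, star_eq_conjTranspose]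
    ring
  have h_integrable (s t : Finset n) : Integrable (fun U : unitaryGroup n ℂ =>
      ((-a) ^ s.card * (-b) ^ t.card) *
          (((U : Matrix n n ℂ).submatrix ((↑) : s → n) (↑)).det *
            star ((U : Matrix n n ℂ).submatrix ((↑) : t → n) (↑)).det)) μ :=
    Continuous.integrable_unitaryGroup μ (by fun_prop)
  simp_rw [hexp]
  rw [integral_finsetSum _ fun s _ => integrable_finsetSum _ fun t _ => h_integrable s t]
  have hs (s : Finset n) : ∫ U : unitaryGroup n ℂ, ∑ t : Finset n,
        ((-a) ^ s.card * (-b) ^ t.card) *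
          (((U : Matrix n n ℂ).submatrix ((↑) : s → n) (↑)).det *
            star ((U : Matrix n n ℂ).submatrix ((↑) : t → n) (↑)).det) ∂μ =
      (a * b) ^ s.card * ((Fintype.card n).choose s.card : ℂ)⁻¹ := by
    rw [integral_finsetSum _ fun t _ => h_integrable s t, Finset.sum_eq_single s]
    · rw [integral_const_mul, integral_minor_mul_star_minor_self, ← mul_pow, neg_mul_neg]
    · intro t _ hts
      rw [integral_const_mul, integral_minor_mul_star_minor_of_ne μ hts.symm, mul_zero]
    · simp
  simp_rw [hs]
  rw [← Finset.powerset_univ, Finset.sum_powerset_apply_card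
    (fun k => (a * b) ^ k * ((Fintype.card n).choose k : ℂ)⁻¹), Finset.card_univ]
  refine Finset.sum_congr rfl fun k hk => ?_
  have hne : ((Fintype.card n).choose k : ℂ) ≠ 0 :=
    Nat.cast_ne_zero.2 (Nat.choose_pos (Nat.lt_succ_iff.1 (Finset.mem_range.1 hk))).ne'
  rw [nsmul_eq_mul, mul_left_comm, mul_inv_cancel₀ hne, mul_one]

end Unitary

end Matrix

/-- The simplest shifted moment over the unitary group:
`∫_{U(N)} det(1 - a U) det(1 - b U*) dU = (1 - (ab)^{N+1})/(1 - ab)`. -/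
theorem unitary_pair_moment (N : ℕ) (hN : 1 ≤ N) (a b : ℂ) (hab : a * b ≠ 1)
    (μ : Measure (Matrix.unitaryGroup (Fin N) ℂ))
    [IsProbabilityMeasure μ] [μ.IsHaarMeasure] :
    (∫ U : Matrix.unitaryGroup (Fin N) ℂ,
        ((1 : Matrix (Fin N) (Fin N) ℂ) - a • (U : Matrix (Fin N) (Fin N) ℂ)).det *
          ((1 : Matrix (Fin N) (Fin N) ℂ) - b • star (U : Matrix (Fin N) (Fin N) ℂ)).det ∂μ)
      = (1 - (a * b) ^ (N + 1)) / (1 - a * b) := by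
  rw [integral_det_one_sub_mul_det_one_sub_star, geom_sum_eq hab, Fintype.card_fin,
    ← neg_sub, ← neg_sub (1 : ℂ), neg_div_neg_eq]
end
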